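/- Let F : ℝ² → ℝ be a smooth function satisfying ΔF + F = 0, and let 0 ≤ s < t. Then the collection of connected components of {x ∈ ℝ² : F(x) ≠ 0} that are entirely contained in the open annulus {x : s < |x| < t} is finite, of cardinality at most (t² − s²)/j_{0,1}². In particular, if t < √2 · j_{0,1} then at most one such component is contained in the open ball {|x| < t}, and if t² − s² < j_{0,1}² then no such component is contained in the annulus {s < |x| < t}. -/

import Mathlib

open Metric MeasureTheory intervalIntegral

/-- The Bessel function of the first kind of integer order `n`:
`J_n(s) = (1/π) ∫₀^π cos (n θ - s sin θ) dθ`. -/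
noncomputable def besselJ (n : ℕ) (s : ℝ) : ℝ :=
  (1 / Real.pi) * ∫ θ in (0:ℝ)..Real.pi, Real.cos (n * θ - s * Real.sin θ)

/-- `besselJZero n k` is the `k`-th smallest positive zero of `J_n` (with the
convention `besselJZero n 0 = 0`). -/
noncomputable def besselJZero (n : ℕ) : ℕ → ℝ
  | 0 => 0
  | k + 1 => sInf {r : ℝ | besselJZero n k < r ∧ besselJ n r = 0}

/-- The Euclidean Laplacian of a function on the plane. -/
noncomputable def laplacian (f : EuclideanSpace ℝ (Fin 2) → ℝ)
    (x : EuclideanSpace ℝ (Fin 2)) : ℝ :=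
  ∑ i : Fin 2, fderiv ℝ (fun y => fderiv ℝ f y (EuclideanSpace.single i 1)) x
    (EuclideanSpace.single i 1)

/-- The set of nodal domains (connected components of `{F ≠ 0}`) of `F` which are
contained in a given set `B`. -/
def nodalDomainsIn (F : EuclideanSpace ℝ (Fin 2) → ℝ)
    (B : Set (EuclideanSpace ℝ (Fin 2))) : Set (Set (EuclideanSpace ℝ (Fin 2))) :=
  {C | (∃ x, F x ≠ 0 ∧ C = connectedComponentIn {y | F y ≠ 0} x) ∧ C ⊆ B}


lemma fk_param_deriv (f f' : ℝ → ℝ → ℝ) (hf : Continuous (fun p : ℝ × ℝ => f p.1 p.2))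
    (hf' : Continuous (fun p : ℝ × ℝ => f' p.1 p.2))
    (h : ∀ s θ, HasDerivAt (fun s => f s θ) (f' s θ) s) (C : ℝ) (a b : ℝ) (hC : ∀ s θ, |f' s θ| ≤ C) (s : ℝ) :
    HasDerivAt (fun s => ∫ θ in a..b, f s θ) (∫ θ in a..b, f' s θ) s := by
  have h1 : ∀ s, Continuous (f s) := fun s => hf.comp (by fun_prop : Continuous fun θ : ℝ => (s, θ))
  have h2 : ∀ s, Continuous (f' s) := fun s => hf'.comp (by fun_prop : Continuous fun θ : ℝ => (s, θ))
  refine (intervalIntegral.hasDerivAt_integral_of_dominated_loc_of_deriv_le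
    (s := Set.univ) (bound := fun _ => C) Filter.univ_mem ?_ ?_ ?_ ?_ ?_ ?_).2
  · exact Filter.Eventually.of_forall fun s => (h1 s).aestronglyMeasurable
  · exact (h1 s).intervalIntegrable _ _
  · exact (h2 s).aestronglyMeasurable
  · exact Filter.Eventually.of_forall fun θ _ s _ => hC s θ
  · exact intervalIntegrable_const
  · exact Filter.Eventually.of_forall fun θ _ s _ => h s θ

/-- `J₀` and its derivative. -/
lemma fk_bessel_ode : ∃ y' : ℝ → ℝ, (∀ s, HasDerivAt (besselJ 0) (y' s) s) ∧ y' 0 = 0 ∧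
    Continuous y' ∧
    (∀ s, HasDerivAt (fun s => s * y' s) (- (s * besselJ 0 s)) s) := by
  have e0 : besselJ 0 = fun s => (1 / Real.pi) * ∫ θ in (0:ℝ)..Real.pi, Real.cos (s * Real.sin θ) := by
    funext s; simp [besselJ]
  have d1 : ∀ s, HasDerivAt (fun s => ∫ θ in (0:ℝ)..Real.pi, Real.cos (s * Real.sin θ))
      (∫ θ in (0:ℝ)..Real.pi, -Real.sin (s * Real.sin θ) * Real.sin θ) s := by
    intro s
    refine fk_param_deriv (fun s θ => Real.cos (s * Real.sin θ))
      (fun s θ => -Real.sin (s * Real.sin θ) * Real.sin θ) (by fun_prop) (by fun_prop) ?_ 1 _ _ ?_ s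
    · intro s θ
      simpa using ((hasDerivAt_id s).mul_const (Real.sin θ)).cos
    · intro s θ
      rw [abs_mul, abs_neg]
      exact mul_le_one₀ (Real.abs_sin_le_one _) (abs_nonneg _) (Real.abs_sin_le_one _)
  have d2 : ∀ s, HasDerivAt (fun s => ∫ θ in (0:ℝ)..Real.pi, -Real.sin (s * Real.sin θ) * Real.sin θ)
      (∫ θ in (0:ℝ)..Real.pi, -(Real.cos (s * Real.sin θ) * Real.sin θ) * Real.sin θ) s := by
    intro s
    refine fk_param_deriv (fun s θ => -Real.sin (s * Real.sin θ) * Real.sin θ)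
      (fun s θ => -(Real.cos (s * Real.sin θ) * Real.sin θ) * Real.sin θ) (by fun_prop) (by fun_prop) ?_ 1 _ _ ?_ s
    · intro s θ
      simpa using ((((hasDerivAt_id s).mul_const (Real.sin θ)).sin).neg).mul_const (Real.sin θ)
    · intro s θ
      rw [abs_mul, abs_neg, abs_mul]
      exact mul_le_one₀ (mul_le_one₀ (Real.abs_cos_le_one _) (abs_nonneg _) (Real.abs_sin_le_one _)) (abs_nonneg _) (Real.abs_sin_le_one _)
  refine ⟨fun s => (1 / Real.pi) * ∫ θ in (0:ℝ)..Real.pi, -Real.sin (s * Real.sin θ) * Real.sin θ,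
    ?_, by simp, ?_, ?_⟩
  · intro s
    rw [e0]
    exact (d1 s).const_mul _
  · exact continuous_iff_continuousAt.2 fun s => ((d2 s).const_mul _).continuousAt
  · intro s
    have := (hasDerivAt_id s).mul ((d2 s).const_mul (1 / Real.pi))
    refine this.congr_deriv ?_
    rw [e0]
    have key : ∫ θ in (0:ℝ)..Real.pi, ((-Real.sin (s * Real.sin θ) * Real.sin θ) +
        (s * (-(Real.cos (s * Real.sin θ) * Real.sin θ) * Real.sin θ) + s * Real.cos (s * Real.sin θ))) = 0 := by
      have : ∀ θ ∈ Set.uIcc (0:ℝ) Real.pi, HasDerivAt (fun θ => Real.cos θ * Real.sin (s * Real.sin θ))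
        ((-Real.sin (s * Real.sin θ) * Real.sin θ) +
        (s * (-(Real.cos (s * Real.sin θ) * Real.sin θ) * Real.sin θ) + s * Real.cos (s * Real.sin θ))) θ := by
        intro θ _
        refine ((Real.hasDerivAt_cos θ).mul (((Real.hasDerivAt_sin θ).const_mul s).sin)).congr_deriv ?_
        have := Real.sin_sq_add_cos_sq θ
        linear_combination (s * Real.cos (s * Real.sin θ)) * this
      rw [integral_eq_sub_of_hasDerivAt this ((by fun_prop : Continuous _).intervalIntegrable _ _)]
      simp
    rw [intervalIntegral.integral_add, intervalIntegral.integral_add, intervalIntegral.integral_const_mul, intervalIntegral.integral_const_mul] at key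
    · simp only [id]
      linear_combination (1 / Real.pi) * key
    all_goals exact (by fun_prop : Continuous _).intervalIntegrable _ _

lemma fk_bessel_zero : besselJ 0 0 = 1 := by
  simp [besselJ, Real.pi_ne_zero]

section ode

lemma fk_ode_N (y y' : ℝ → ℝ) (hy : ∀ s, HasDerivAt y (y' s) s)
    (hP : ∀ s, HasDerivAt (fun s => s * y' s) (- (s * y s)) s) (s : ℝ) (hs : 0 ≤ s) :
    0 ≤ (s * y' s) ^ 2 + s ^ 2 * y s ^ 2 + s * y' s * y s := by
  have hd : ∀ s, HasDerivAt (fun s => (s * y' s) ^ 2 + s ^ 2 * y s ^ 2 + s * y' s * y s)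
      (s * (y s ^ 2 + y' s ^ 2)) s := by
    intro s
    refine ((((hP s).pow 2).add (((hasDerivAt_id s).pow 2).mul ((hy s).pow 2))).add
      ((hP s).mul (hy s))).congr_deriv ?_
    simp only [id, Pi.pow_apply]
    ring
  have hm : MonotoneOn (fun s => (s * y' s) ^ 2 + s ^ 2 * y s ^ 2 + s * y' s * y s) (Set.Ici 0) := by
    refine monotoneOn_of_hasDerivWithinAt_nonneg (convex_Ici 0)
      (f' := fun s => s * (y s ^ 2 + y' s ^ 2)) ?_ ?_ ?_
    · exact fun s _ => (hd s).continuousAt.continuousWithinAt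
    · exact fun s _ => (hd s).hasDerivWithinAt
    · intro s hs
      rw [interior_Ici] at hs
      have : (0:ℝ) < s := hs
      positivity
  have := hm (Set.mem_Ici.2 le_rfl) (Set.mem_Ici.2 hs) hs
  simpa using this

lemma fk_ode_q_deriv (y y' : ℝ → ℝ) (hy : ∀ s, HasDerivAt y (y' s) s)
    (hP : ∀ s, HasDerivAt (fun s => s * y' s) (- (s * y s)) s) (s : ℝ) (hs : 0 < s) (hpos : y s ≠ 0) :
    HasDerivAt (fun s => - y' s / y s)
      (1 + (- y' s / y s) ^ 2 - (- y' s / y s) / s) s := by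
  have h1 : HasDerivAt y' (-y s - y' s / s) s := by
    have h2 : HasDerivAt (fun s => (s * y' s) / s) (-y s - y' s / s) s := by
      refine ((hP s).div (hasDerivAt_id s) hs.ne').congr_deriv ?_
      simp only [id]
      field_simp
    refine h2.congr_of_eventuallyEq ?_
    filter_upwards [lt_mem_nhds hs] with u hu
    field_simp
  refine (h1.neg.div (hy s) hpos).congr_deriv ?_
  simp only [Pi.neg_apply]
  field_simp
  ring

lemma fk_ode_q_mono (y y' : ℝ → ℝ) (hy : ∀ s, HasDerivAt y (y' s) s) (hc : Continuous y')
    (hP : ∀ s, HasDerivAt (fun s => s * y' s) (- (s * y s)) s) (b : ℝ)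
    (hpos : ∀ s ∈ Set.Icc 0 b, 0 < y s) :
    MonotoneOn (fun s => - y' s / y s) (Set.Icc 0 b) := by
  have hyc : Continuous y := continuous_iff_continuousAt.2 fun s => (hy s).continuousAt
  refine monotoneOn_of_hasDerivWithinAt_nonneg (convex_Icc 0 b)
      (f' := fun s => 1 + (- y' s / y s) ^ 2 - (- y' s / y s) / s) ?_ ?_ ?_
  · exact (hc.neg.continuousOn).div hyc.continuousOn fun s hs => (hpos s hs).ne'
  · intro s hs
    rw [interior_Icc] at hs
    exact (fk_ode_q_deriv y y' hy hP s hs.1 (hpos s ⟨hs.1.le, hs.2.le⟩).ne').hasDerivWithinAt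
  · intro s hs
    rw [interior_Icc] at hs
    have h1 := hpos s ⟨hs.1.le, hs.2.le⟩
    have h2 := hs.1
    have h3 := fk_ode_N y y' hy hP s h2.le
    have : 1 + (- y' s / y s) ^ 2 - (- y' s / y s) / s
      = ((s * y' s) ^ 2 + s ^ 2 * y s ^ 2 + s * y' s * y s) / (s ^ 2 * y s ^ 2) := by
      field_simp
      ring
    rw [this]
    positivity

lemma fk_ode_h_deriv (y y' : ℝ → ℝ) (hy : ∀ s, HasDerivAt y (y' s) s)
    (hP : ∀ s, HasDerivAt (fun s => s * y' s) (- (s * y s)) s) (s : ℝ) (hpos : y s ≠ 0) :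
    HasDerivAt (fun s => s * (- y' s / y s)) (s * (1 + (- y' s / y s) ^ 2)) s := by
  have := ((hP s).neg.div (hy s) hpos)
  have e : (fun s => s * (- y' s / y s)) = (-(fun s => s * y' s)) / y := by
    funext s; simp only [Pi.div_apply, Pi.neg_apply]; ring
  rw [e]
  refine this.congr_deriv ?_
  simp only [Pi.neg_apply]
  field_simp
  ring

lemma fk_ode_g (y y' : ℝ → ℝ) (hy : ∀ s, HasDerivAt y (y' s) s) (hc : Continuous y')
    (hP : ∀ s, HasDerivAt (fun s => s * y' s) (- (s * y s)) s) (b : ℝ)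
    (hpos : ∀ s ∈ Set.Icc 0 b, 0 < y s) (r : ℝ) (hr0 : 0 ≤ r) (hrb : r ≤ b) (hq0 : 0 ≤ - y' r / y r) :
    (- y' r / y r) ^ 2 * (b ^ 2 - r ^ 2) ≤
      (2 * (b * (- y' b / y b)) - b ^ 2) - (2 * (r * (- y' r / y r)) - r ^ 2) := by
  set c := (- y' r / y r) with hcdef
  have hmono := fk_ode_q_mono y y' hy hc hP b hpos
  have hd : ∀ s ∈ Set.Icc r b, HasDerivAt
      (fun s => 2 * (s * (- y' s / y s)) - s ^ 2 - c ^ 2 * s ^ 2)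
      (2 * s * ((- y' s / y s) ^ 2 - c ^ 2)) s := by
    intro s hs
    have hp := hpos s ⟨hr0.trans hs.1, hs.2⟩
    refine ((((fk_ode_h_deriv y y' hy hP s hp.ne').const_mul 2).sub ((hasDerivAt_id s).pow 2)).sub
      (((hasDerivAt_id s).pow 2).const_mul (c ^ 2))).congr_deriv ?_
    simp only [id]
    ring
  have hm : MonotoneOn (fun s => 2 * (s * (- y' s / y s)) - s ^ 2 - c ^ 2 * s ^ 2) (Set.Icc r b) := by
    refine monotoneOn_of_hasDerivWithinAt_nonneg (convex_Icc r b)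
      (f' := fun s => (2 * s * ((- y' s / y s) ^ 2 - c ^ 2))) ?_ ?_ ?_
    · exact fun s hs => (hd s hs).continuousAt.continuousWithinAt
    · exact fun s hs => (hd s (interior_subset hs)).hasDerivWithinAt
    · intro s hs
      have hs := interior_subset hs
      have h1 : c ≤ - y' s / y s := hmono ⟨hr0, hrb⟩ ⟨hr0.trans hs.1, hs.2⟩ hs.1
      have h2 : c ^ 2 ≤ (- y' s / y s) ^ 2 := by gcongr
      have h3 : 0 ≤ s := hr0.trans hs.1
      have h4 : 0 ≤ (- y' s / y s) ^ 2 - c ^ 2 := by linarith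
      positivity
  have := hm (Set.left_mem_Icc.2 hrb) (Set.right_mem_Icc.2 hrb) hrb
  simp only at this
  rw [← hcdef] at this
  linarith

lemma fk_ode_zero (y y' : ℝ → ℝ) (hy : ∀ s, HasDerivAt y (y' s) s) (hc : Continuous y')
    (hP : ∀ s, HasDerivAt (fun s => s * y' s) (- (s * y s)) s) (hy'0 : y' 0 = 0)
    (hpos : ∀ s, 0 ≤ s → 0 < y s) : False := by
  have hyc : Continuous y := continuous_iff_continuousAt.2 fun s => (hy s).continuousAt
  have hmono : ∀ b, MonotoneOn (fun s => - y' s / y s) (Set.Icc 0 b) := fun b =>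
    fk_ode_q_mono y y' hy hc hP b fun s hs => hpos s hs.1
  have hh : ∀ R, 0 < R → R * (- y' R / y R) ≤ R ^ 2 / 2 * (1 + (- y' R / y R) ^ 2) := by
    intro R hR
    set c := (- y' R / y R) with hcdef
    have hm : MonotoneOn (fun s => s ^ 2 / 2 * (1 + c ^ 2) - s * (- y' s / y s)) (Set.Icc 0 R) := by
      have hd : ∀ s ∈ Set.Icc 0 R, HasDerivAt
          (fun s => s ^ 2 / 2 * (1 + c ^ 2) - s * (- y' s / y s))
          (s * (c ^ 2 - (- y' s / y s) ^ 2)) s := by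
        intro s hs
        refine (((((hasDerivAt_id s).pow 2).div_const 2).mul_const (1 + c ^ 2)).sub
          (fk_ode_h_deriv y y' hy hP s (hpos s hs.1).ne')).congr_deriv ?_
        simp only [id]
        ring
      refine monotoneOn_of_hasDerivWithinAt_nonneg (convex_Icc 0 R)
        (f' := fun s => s * (c ^ 2 - (- y' s / y s) ^ 2)) ?_ ?_ ?_
      · exact fun s hs => (hd s hs).continuousAt.continuousWithinAt
      · exact fun s hs => (hd s (interior_subset hs)).hasDerivWithinAt
      · intro s hs
        have hs := interior_subset hs
        have h1 : - y' s / y s ≤ c := hmono R hs ⟨hR.le, le_rfl⟩ hs.2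
        have h0 : 0 ≤ - y' s / y s := by
          have := hmono R ⟨le_rfl, hR.le⟩ hs hs.1
          simpa [hy'0] using this
        have h2 : (- y' s / y s) ^ 2 ≤ c ^ 2 := by gcongr
        have h4 : 0 ≤ c ^ 2 - (- y' s / y s) ^ 2 := by linarith
        have := hs.1
        positivity
    have := hm ⟨le_rfl, hR.le⟩ ⟨hR.le, le_rfl⟩ hR.le
    simp only at this
    rw [← hcdef] at this
    simp at this
    linarith
  have hm : MonotoneOn (fun s => Real.arctan (- y' s / y s) - s / 2) (Set.Ici 0) := by
    refine monotoneOn_of_hasDerivWithinAt_nonneg (convex_Ici 0)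
        (f' := fun s => 1 / (1 + (- y' s / y s) ^ 2) * (1 + (- y' s / y s) ^ 2 - (- y' s / y s) / s)
          - 1 / 2) ?_ ?_ ?_
    · refine (Real.continuous_arctan.comp_continuousOn ((hc.neg.continuousOn).div hyc.continuousOn
        fun s hs => (hpos s hs).ne')).sub (by fun_prop)
    · intro s hs
      rw [interior_Ici] at hs
      exact ((fk_ode_q_deriv y y' hy hP s hs (hpos s (le_of_lt hs)).ne').arctan.sub
        ((hasDerivAt_id s).div_const 2)).hasDerivWithinAt
    · intro s hs
      rw [interior_Ici] at hs
      have hs : (0:ℝ) < s := hs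
      have := hh s hs
      set c := (- y' s / y s) with hcdef
      have h1 : c / s ≤ (1 + c ^ 2) / 2 := by
        rw [div_le_iff₀ hs]
        have h2 : s * (c - s / 2 * (1 + c ^ 2)) ≤ 0 := by linarith
        have h3 : c - s / 2 * (1 + c ^ 2) ≤ 0 := by
          by_contra hcon
          push Not at hcon
          have := mul_pos hs hcon
          linarith
        linarith
      have h4 : (0:ℝ) < 1 + c ^ 2 := by positivity
      rw [sub_nonneg, one_div_mul_eq_div, le_div_iff₀ h4]
      linarith
  have := hm (Set.mem_Ici.2 le_rfl) (Set.mem_Ici.2 Real.pi_pos.le) Real.pi_pos.le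
  simp only [hy'0] at this
  have h2 := Real.arctan_lt_pi_div_two (- y' Real.pi / y Real.pi)
  simp at this
  linarith

end ode

lemma fk_besselJZero_pos : 0 < besselJZero 0 1 ∧ ∀ s, 0 ≤ s → s < besselJZero 0 1 → 0 < besselJ 0 s := by
  obtain ⟨y', hy, hy'0, hc, hP⟩ := fk_bessel_ode
  have hyc : Continuous (besselJ 0) := continuous_iff_continuousAt.2 fun s => (hy s).continuousAt
  have hdef : besselJZero 0 1 = sInf {r : ℝ | 0 < r ∧ besselJ 0 r = 0} := by
    simp [besselJZero]
  have ivt : ∀ b, 0 ≤ b → besselJ 0 b ≤ 0 → ∃ r, 0 < r ∧ r ≤ b ∧ besselJ 0 r = 0 := by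
    intro b hb h
    have := intermediate_value_Icc' hb hyc.continuousOn
    obtain ⟨r, hr, hr2⟩ := this ⟨h, by rw [fk_bessel_zero]; exact zero_le_one⟩
    refine ⟨r, lt_of_le_of_ne hr.1 ?_, hr.2, hr2⟩
    rintro rfl
    rw [fk_bessel_zero] at hr2
    exact one_ne_zero hr2
  have hne : {r : ℝ | 0 < r ∧ besselJ 0 r = 0}.Nonempty := by
    by_contra hcon
    refine fk_ode_zero (besselJ 0) y' hy hc hP hy'0 fun s hs => ?_
    by_contra h
    obtain ⟨r, h1, h2, h3⟩ := ivt s hs (not_lt.1 h)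
    exact hcon ⟨r, h1, h3⟩
  have hbdd : BddBelow {r : ℝ | 0 < r ∧ besselJ 0 r = 0} := ⟨0, fun r hr => hr.1.le⟩
  constructor
  · have h1 : ∀ᶠ s in nhds (0:ℝ), 0 < besselJ 0 s :=
      hyc.continuousAt.eventually (lt_mem_nhds (by rw [fk_bessel_zero]; exact zero_lt_one))
    obtain ⟨δ, hδ, h2⟩ := Metric.eventually_nhds_iff.1 h1
    rw [hdef]
    refine lt_of_lt_of_le hδ (le_csInf hne ?_)
    rintro r ⟨hr, hr2⟩
    by_contra hlt
    have := h2 (y := r) (by rw [Real.dist_eq, sub_zero, abs_of_pos hr]; exact not_le.1 hlt)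
    linarith
  · intro s hs hlt
    by_contra h
    obtain ⟨r, h1, h2, h3⟩ := ivt s hs (not_lt.1 h)
    have := csInf_le hbdd (show r ∈ {r : ℝ | 0 < r ∧ besselJ 0 r = 0} from ⟨h1, h3⟩)
    rw [hdef] at hlt
    linarith

/-- The radial comparison data. -/
lemma fk_comparison (M : ℝ) (hM : 0 ≤ M) (hMj : M < Real.pi * besselJZero 0 1 ^ 2) :
    ∃ (lam : ℝ) (q R : ℝ → ℝ), 1 < lam ∧ R 0 = 0 ∧ (∀ m ∈ Set.Icc 0 M, 0 ≤ q m) ∧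
      (∀ m' m, 0 ≤ m' → m' ≤ m → m ≤ M → q m' ^ 2 * (m - m') ≤ R m - R m') ∧
      (∀ m ∈ Set.Icc 0 M, 2 * Real.sqrt (Real.pi * m) * q m = lam * m + R m) := by
  obtain ⟨y', hy, hy'0, hc, hP⟩ := fk_bessel_ode
  obtain ⟨hj, hpos⟩ := fk_besselJZero_pos
  set j := besselJZero 0 1
  have hpi := Real.pi_pos
  set ρ : ℝ := Real.sqrt (M / Real.pi) with hρ
  have hρj : ρ < j := by
    rw [hρ, Real.sqrt_lt' hj, div_lt_iff₀ hpi]; linarith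
  have hρ0 : 0 ≤ ρ := Real.sqrt_nonneg _
  obtain ⟨κ, hκ1, hκ⟩ : ∃ κ : ℝ, 1 < κ ∧ κ * ρ < j := by
    rcases eq_or_lt_of_le hρ0 with h | h
    · exact ⟨2, by norm_num, by rw [← h]; simpa using hj⟩
    · obtain ⟨z, hz1, hz2⟩ := exists_between hρj
      exact ⟨z / ρ, by rwa [lt_div_iff₀ h, one_mul], by rwa [div_mul_cancel₀ _ h.ne']⟩
  have hκ0 : 0 < κ := by linarith
  let r : ℝ → ℝ := fun m => κ * Real.sqrt (m / Real.pi)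
  have hr0 : ∀ m, 0 ≤ r m := fun m => by positivity
  have hrmono : ∀ m' m, m' ≤ m → r m' ≤ r m := fun m' m h => by
    simp only [r]; gcongr
  have hrj : ∀ m, m ≤ M → r m < j := fun m hm => lt_of_le_of_lt (hrmono m M hm) hκ
  have hr2 : ∀ m, 0 ≤ m → Real.pi * r m ^ 2 = κ ^ 2 * m := fun m hm => by
    simp only [r]
    rw [mul_pow, Real.sq_sqrt (by positivity)]
    field_simp
  let Q : ℝ → ℝ := fun s => - y' s / besselJ 0 s
  have hQ0 : ∀ m, m ≤ M → 0 ≤ Q (r m) := by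
    intro m hm
    have := fk_ode_q_mono _ y' hy hc hP (r m) (fun s hs => hpos s hs.1 (lt_of_le_of_lt hs.2 (hrj m hm)))
      ⟨le_rfl, hr0 m⟩ ⟨hr0 m, le_rfl⟩ (hr0 m)
    simpa [hy'0] using this
  refine ⟨κ ^ 2, fun m => κ * Q (r m), fun m => Real.pi * (2 * (r m * Q (r m)) - r m ^ 2), ?_, ?_, ?_, ?_, ?_⟩
  · nlinarith
  · simp [r]
  · intro m hm
    have := hQ0 m hm.2
    positivity
  · intro m' m h0 h1 h2
    have := fk_ode_g _ y' hy hc hP (r m) (fun s hs => hpos s hs.1 (lt_of_le_of_lt hs.2 (hrj m h2)))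
      (r m') (hr0 m') (hrmono _ _ h1) (hQ0 m' (h1.trans h2))
    have e1 := hr2 m (h0.trans h1)
    have e2 := hr2 m' h0
    have := mul_le_mul_of_nonneg_left this hpi.le
    have e3 : (κ * Q (r m')) ^ 2 * (m - m') = Real.pi * (Q (r m') ^ 2 * (r m ^ 2 - r m' ^ 2)) := by
      linear_combination Q (r m') ^ 2 * (e2 - e1)
    rw [e3]
    refine this.trans (le_of_eq ?_)
    simp only [Q]
    ring
  · intro m hm
    have e1 := hr2 m hm.1
    have e2 : Real.sqrt (Real.pi * m) * κ = Real.pi * r m := by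
      simp only [r]
      have : Real.pi * m = Real.pi ^ 2 * (m / Real.pi) := by field_simp
      rw [this, Real.sqrt_mul (by positivity), Real.sqrt_sq hpi.le]
      ring
    linear_combination (2 * Q (r m)) * e2 + e1

/-- `θ + sin θ cos θ` as an order isomorphism of the line. -/
lemma fk_angle : ∃ Th : ℝ → ℝ, Continuous Th ∧ (∀ c, |c| < Real.pi / 2 → 0 < Real.cos (Th c)) ∧
    ∀ c, |c| < Real.pi / 2 → HasDerivAt Th (1 / (2 * Real.cos (Th c) ^ 2)) c := by
  let H : ℝ → ℝ := fun θ => θ + Real.sin θ * Real.cos θ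
  have hd : ∀ θ, HasDerivAt H (2 * Real.cos θ ^ 2) θ := by
    intro θ
    refine ((hasDerivAt_id θ).add ((Real.hasDerivAt_sin θ).mul (Real.hasDerivAt_cos θ))).congr_deriv ?_
    have := Real.sin_sq_add_cos_sq θ
    linear_combination -this
  have hcont : Continuous H := by fun_prop
  have hsm : StrictMono H := by
    intro a b hab
    have : Real.sin (2 * b) - Real.sin (2 * a) > - (2 * (b - a)) := by
      have h1 := Real.sin_sub_sin (2 * b) (2 * a)
      have h3 : |Real.sin ((2 * b - 2 * a) / 2)| < b - a := by
        have := Real.abs_sin_lt_abs (x := (2 * b - 2 * a) / 2) (by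
          intro h; linarith)
        rw [abs_of_pos (by linarith : (0:ℝ) < (2 * b - 2 * a) / 2)] at this
        linarith
      have h4 : |Real.sin ((2 * b - 2 * a) / 2) * Real.cos ((2 * b + 2 * a) / 2)| < b - a := by
        rw [abs_mul]
        calc _ ≤ |Real.sin ((2 * b - 2 * a) / 2)| * 1 := by
              gcongr; exact Real.abs_cos_le_one _
          _ < b - a := by linarith
      have := (abs_lt.1 h4).1
      rw [h1]; linarith
    rw [Real.sin_two_mul, Real.sin_two_mul] at this
    simp only [H]
    linarith
  have hsurj : Function.Surjective H := by
    refine hcont.surjective ?_ ?_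
    · refine Filter.tendsto_atTop_mono (f := fun θ : ℝ => θ - 1) ?_ (Filter.tendsto_atTop_add_const_right _ _ Filter.tendsto_id)
      intro θ
      have : |Real.sin θ * Real.cos θ| ≤ 1 := by
        rw [abs_mul]; exact mul_le_one₀ (Real.abs_sin_le_one _) (abs_nonneg _) (Real.abs_cos_le_one _)
      have := (abs_le.1 this).1
      simp only [H]; linarith
    · refine Filter.tendsto_atBot_mono (f := fun θ : ℝ => θ + 1) ?_ (Filter.tendsto_atBot_add_const_right _ _ Filter.tendsto_id)
      intro θ
      have : |Real.sin θ * Real.cos θ| ≤ 1 := by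
        rw [abs_mul]; exact mul_le_one₀ (Real.abs_sin_le_one _) (abs_nonneg _) (Real.abs_cos_le_one _)
      have := (abs_le.1 this).2
      simp only [H]; linarith
  let e := hsm.orderIsoOfSurjective H hsurj
  have he : ∀ c, H (e.symm c) = c := fun c => e.apply_symm_apply c
  have hce : Continuous e.symm := e.symm.continuous
  have hcos : ∀ c, |c| < Real.pi / 2 → 0 < Real.cos (e.symm c) := by
    intro c hc
    have hc := abs_lt.1 hc
    refine Real.cos_pos_of_mem_Ioo ⟨?_, ?_⟩
    · rw [← hsm.lt_iff_lt, he]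
      simpa [H] using hc.1
    · rw [← hsm.lt_iff_lt, he]
      simpa [H] using hc.2
  refine ⟨e.symm, hce, hcos, ?_⟩
  intro c hc
  rw [one_div]
  refine HasDerivAt.of_local_left_inverse hce.continuousAt (hd _) ?_ (Filter.Eventually.of_forall he)
  have := hcos c hc
  positivity

lemma fk_box (L : ℝ) (g : ℝ × ℝ → ℝ) (hg : Continuous g)
    (h0 : ∀ p : ℝ × ℝ, (L ≤ |p.1| ∨ L ≤ |p.2|) → g p = 0) :
    ∫ p, g p = ∫ x in (-L)..L, ∫ y in (-L)..L, g (x, y) := by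
  have hsup : ∀ p, g p ≠ 0 → |p.1| < L ∧ |p.2| < L := by
    intro p hp
    by_contra h
    exact hp (h0 p (by rw [not_and_or, not_lt, not_lt] at h; exact h))
  have hcs : HasCompactSupport g := by
    refine HasCompactSupport.of_support_subset_isCompact
      ((isCompact_Icc (a := -L) (b := L)).prod (isCompact_Icc (a := -L) (b := L))) ?_
    intro p hp
    obtain ⟨h1, h2⟩ := hsup p hp
    exact ⟨⟨(abs_lt.1 h1).1.le, (abs_lt.1 h1).2.le⟩, ⟨(abs_lt.1 h2).1.le, (abs_lt.1 h2).2.le⟩⟩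
  have hinteg : Integrable g := hg.integrable_of_hasCompactSupport hcs
  have e1 : ∀ x, ∫ y in (-L)..L, g (x, y) = ∫ y, g (x, y) := by
    intro x
    refine intervalIntegral.integral_eq_integral_of_support_subset ?_
    intro y hy
    obtain ⟨h1, h2⟩ := hsup (x, y) hy
    exact ⟨(abs_lt.1 h2).1, (abs_lt.1 h2).2.le⟩
  simp_rw [e1]
  rw [intervalIntegral.integral_eq_integral_of_support_subset]
  · rw [Measure.volume_eq_prod] at hinteg ⊢
    exact integral_prod g hinteg
  · intro x hx
    by_contra hcon
    apply hx
    have : ∀ y, g (x, y) = 0 := by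
      intro y
      apply h0
      left
      by_contra h
      exact hcon ⟨(abs_lt.1 (not_le.1 h)).1, (abs_lt.1 (not_le.1 h)).2.le⟩
    simp [this]

/-- Slice inequality in the Knothe argument. -/
lemma fk_slice (L : ℝ) (hL : 0 < L) (w wx wy : ℝ → ℝ) (hw : ∀ y, HasDerivAt w (wy y) y)
    (hwx : Continuous wx) (hwy : Continuous wy) (hw0 : ∀ y, 0 ≤ w y)
    (hwl : w (-L) = 0) (hwr : w L = 0) (f1 a c θ : ℝ) (hf1 : f1 = ∫ y in (-L)..L, w y ^ 2)
    (hcos : 0 < Real.cos θ) (hc : 0 ≤ c) (ha : a = c ^ 2 * f1 / (2 * Real.cos θ)) :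
    - (Real.sin θ * ∫ y in (-L)..L, wx y) - a * (∫ y in (-L)..L, w y) + 2 * c * f1
      ≤ ∫ y in (-L)..L, Real.sqrt (wx y ^ 2 + wy y ^ 2) := by
  have hwc : Continuous w := continuous_iff_continuousAt.2 fun y => (hw y).continuousAt
  have hLL : -L ≤ L := by linarith
  have hf1n : 0 ≤ f1 := by
    rw [hf1]; exact intervalIntegral.integral_nonneg hLL fun y _ => sq_nonneg _
  rcases eq_or_lt_of_le hf1n with h0 | hpos
  · have ha0 : a = 0 := by rw [ha, ← h0]; simp
    rw [ha0, ← h0, ← intervalIntegral.integral_const_mul]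
    simp only [zero_mul, sub_zero, mul_zero, add_zero]
    rw [← intervalIntegral.integral_neg]
    refine intervalIntegral.integral_mono_on hLL ((by fun_prop : Continuous _).intervalIntegrable _ _)
      ((by fun_prop : Continuous _).intervalIntegrable _ _) ?_
    intro y _
    apply Real.le_sqrt_of_sq_le
    have := Real.sin_sq_le_one θ
    nlinarith [sq_nonneg (wx y), sq_nonneg (wy y)]
  · let F2 : ℝ → ℝ := fun y => ∫ z in (-L)..y, w z ^ 2
    have hF2 : ∀ y, HasDerivAt F2 (w y ^ 2) y := fun y =>
      (by fun_prop : Continuous fun z => w z ^ 2).integral_hasStrictDerivAt _ _ |>.hasDerivAt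
    have hF2c : Continuous F2 := continuous_iff_continuousAt.2 fun y => (hF2 y).continuousAt
    let T : ℝ → ℝ := fun y => Real.cos θ * (2 * F2 y / f1 - 1)
    let b : ℝ → ℝ := fun y => Real.cos θ * (2 * w y ^ 2 / f1)
    have hT : ∀ y, HasDerivAt T (b y) y := fun y =>
      ((((hF2 y).const_mul 2).div_const f1).sub_const 1).const_mul (Real.cos θ)
    have hTc : Continuous T := continuous_iff_continuousAt.2 fun y => (hT y).continuousAt
    have hbc : Continuous b := by fun_prop
    have hparts : ∫ y in (-L)..L, (wy y * T y + w y * b y) = 0 := by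
      rw [intervalIntegral.integral_eq_sub_of_hasDerivAt (f := fun y => w y * T y)
        (fun y _ => (hw y).mul (hT y)) ((by fun_prop : Continuous _).intervalIntegrable _ _)]
      simp [hwl, hwr]
    have hkey : ∫ y in (-L)..L, (- (Real.sin θ * wx y) - a * w y + 2 * c * w y ^ 2 - (wy y * T y + w y * b y))
        ≤ ∫ y in (-L)..L, (Real.sqrt (wx y ^ 2 + wy y ^ 2) - w y * (a + b y - 2 * c * w y)) := by
      refine intervalIntegral.integral_mono_on hLL ((by fun_prop : Continuous _).intervalIntegrable _ _)
        ((by fun_prop : Continuous _).intervalIntegrable _ _) ?_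
      intro y hy
      have hF0 : 0 ≤ F2 y := intervalIntegral.integral_nonneg hy.1 fun y _ => sq_nonneg _
      have hF1 : F2 y ≤ f1 := by
        have : F2 y + ∫ z in y..L, w z ^ 2 = f1 := by
          rw [hf1]
          exact intervalIntegral.integral_add_adjacent_intervals
            ((by fun_prop : Continuous _).intervalIntegrable _ _) ((by fun_prop : Continuous _).intervalIntegrable _ _)
        have h2 : 0 ≤ ∫ z in y..L, w z ^ 2 := intervalIntegral.integral_nonneg hy.2 fun y _ => sq_nonneg _
        linarith
      have hTb : T y ^ 2 ≤ Real.cos θ ^ 2 := by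
        simp only [T]
        rw [mul_pow]
        have h1 : 0 ≤ F2 y / f1 := by positivity
        have h2 : F2 y / f1 ≤ 1 := by rw [div_le_one hpos]; exact hF1
        have : (2 * F2 y / f1 - 1) ^ 2 ≤ 1 := by
          rw [mul_div_assoc]; nlinarith
        nlinarith [sq_nonneg (Real.cos θ)]
      have hcs : - (Real.sin θ * wx y + wy y * T y) ≤ Real.sqrt (wx y ^ 2 + wy y ^ 2) := by
        apply Real.le_sqrt_of_sq_le
        have h1 : Real.sin θ ^ 2 + T y ^ 2 ≤ 1 := by
          have := Real.sin_sq_add_cos_sq θ; linarith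
        nlinarith [sq_nonneg (Real.sin θ * wy y - T y * wx y), sq_nonneg (wx y), sq_nonneg (wy y)]
      nlinarith
    have hpt : ∀ y, 0 ≤ w y * (a + b y - 2 * c * w y) := by
      intro y
      refine mul_nonneg (hw0 y) ?_
      have ha0 : 0 ≤ a := by rw [ha]; positivity
      have hb0 : 0 ≤ b y := by simp only [b]; positivity
      have hab : a * b y = c ^ 2 * w y ^ 2 := by
        rw [ha]; simp only [b]; field_simp
      have : 2 * c * w y ≤ a + b y := by
        have h := hw0 y
        apply (sq_le_sq₀ (by positivity) (by positivity)).1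
        nlinarith [sq_nonneg (a - b y)]
      linarith
    have h3 : ∫ y in (-L)..L, (Real.sqrt (wx y ^ 2 + wy y ^ 2) - w y * (a + b y - 2 * c * w y))
        ≤ ∫ y in (-L)..L, Real.sqrt (wx y ^ 2 + wy y ^ 2) := by
      refine intervalIntegral.integral_mono_on hLL ((by fun_prop : Continuous _).intervalIntegrable _ _)
        ((by fun_prop : Continuous _).intervalIntegrable _ _) ?_
      intro y hy
      linarith [hpt y]
    refine le_trans (le_of_eq ?_) (hkey.trans h3)
    rw [intervalIntegral.integral_sub, hparts, intervalIntegral.integral_add, intervalIntegral.integral_sub,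
      intervalIntegral.integral_neg, intervalIntegral.integral_const_mul, intervalIntegral.integral_const_mul,
      intervalIntegral.integral_const_mul, ← hf1, sub_zero]
    all_goals exact (by fun_prop : Continuous _).intervalIntegrable _ _

lemma fk_sobolev (w : ℝ × ℝ → ℝ) (hw : ContDiff ℝ 1 w) (hcs : HasCompactSupport w)
    (hw0 : ∀ p, 0 ≤ w p) :
    4 * Real.pi * ∫ p, w p ^ 2 ≤
      (∫ p, Real.sqrt (fderiv ℝ w p (1, 0) ^ 2 + fderiv ℝ w p (0, 1) ^ 2)) ^ 2 := by
  obtain ⟨L, hL, hsupp⟩ : ∃ L : ℝ, 0 < L ∧ ∀ p : ℝ × ℝ, (L ≤ |p.1| ∨ L ≤ |p.2|) → p ∉ tsupport w := by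
    obtain ⟨L, hL, h⟩ := hcs.isBounded.subset_ball_lt 0 0
    refine ⟨L, hL, fun p hp hmem => ?_⟩
    have := h hmem
    rw [mem_ball_zero_iff, Prod.norm_def, max_lt_iff, Real.norm_eq_abs, Real.norm_eq_abs] at this
    rcases hp with hp | hp
    · linarith [this.1]
    · linarith [this.2]
  have hw_zero : ∀ p : ℝ × ℝ, (L ≤ |p.1| ∨ L ≤ |p.2|) → w p = 0 := fun p hp =>
    image_eq_zero_of_notMem_tsupport (hsupp p hp)
  have hfd_zero : ∀ p : ℝ × ℝ, (L ≤ |p.1| ∨ L ≤ |p.2|) → fderiv ℝ w p = 0 := fun p hp => by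
    have : p ∉ tsupport (fderiv ℝ w) := fun h => hsupp p hp (tsupport_fderiv_subset ℝ h)
    exact image_eq_zero_of_notMem_tsupport this
  have hwc : Continuous w := hw.continuous
  have hfc : Continuous (fderiv ℝ w) := hw.continuous_fderiv (by norm_num)
  let wx : ℝ × ℝ → ℝ := fun p => fderiv ℝ w p (1, 0)
  let wy : ℝ × ℝ → ℝ := fun p => fderiv ℝ w p (0, 1)
  have hwxc : Continuous wx := by fun_prop
  have hwyc : Continuous wy := by fun_prop
  have hdiff : Differentiable ℝ w := hw.differentiable (by norm_num)
  have hdx : ∀ x y, HasDerivAt (fun x => w (x, y)) (wx (x, y)) x := fun x y =>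
    (hdiff (x, y)).hasFDerivAt.comp_hasDerivAt x ((hasDerivAt_id x).prodMk (hasDerivAt_const x y))
  have hdy : ∀ x y, HasDerivAt (fun y => w (x, y)) (wy (x, y)) y := fun x y =>
    (hdiff (x, y)).hasFDerivAt.comp_hasDerivAt y ((hasDerivAt_const y x).prodMk (hasDerivAt_id y))
  obtain ⟨C, hC⟩ : ∃ C, ∀ p, |wx p| ≤ C := by
    have : HasCompactSupport wx := by
      refine HasCompactSupport.of_support_subset_isCompact hcs ?_
      intro p hp
      by_contra h
      apply hp
      have : p ∉ tsupport (fderiv ℝ w) := fun h' => h (tsupport_fderiv_subset ℝ h')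
      simp [wx, image_eq_zero_of_notMem_tsupport this]
    obtain ⟨C, hC⟩ := this.exists_bound_of_continuous hwxc
    exact ⟨C, hC⟩
  change 4 * Real.pi * ∫ p, w p ^ 2 ≤ (∫ p, Real.sqrt (wx p ^ 2 + wy p ^ 2)) ^ 2
  rw [fk_box L (fun p => w p ^ 2) (by fun_prop) (fun p hp => by simp [hw_zero p hp]),
    fk_box L (fun p => Real.sqrt (wx p ^ 2 + wy p ^ 2)) (by fun_prop)
      (fun p hp => by simp [wx, wy, hfd_zero p hp])]
  let f1 : ℝ → ℝ := fun x => ∫ y in (-L)..L, w (x, y) ^ 2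
  let W : ℝ → ℝ := fun x => ∫ y in (-L)..L, w (x, y)
  let X : ℝ → ℝ := fun x => ∫ y in (-L)..L, wx (x, y)
  let D : ℝ → ℝ := fun x => ∫ y in (-L)..L, Real.sqrt (wx (x, y) ^ 2 + wy (x, y) ^ 2)
  have hf1c : Continuous f1 :=
    intervalIntegral.continuous_parametric_intervalIntegral_of_continuous' (by fun_prop) _ _
  have hXc : Continuous X :=
    intervalIntegral.continuous_parametric_intervalIntegral_of_continuous' (by fun_prop) _ _
  have hDc : Continuous D :=
    intervalIntegral.continuous_parametric_intervalIntegral_of_continuous' (by fun_prop) _ _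
  have hWd : ∀ x, HasDerivAt W (X x) x := fun x =>
    fk_param_deriv (fun x y => w (x, y)) (fun x y => wx (x, y)) (by fun_prop) (by fun_prop) hdx C _ _
      (fun x y => hC (x, y)) x
  have hLL : -L ≤ L := by linarith
  have hWl : W (-L) = 0 := by
    have : ∀ y, w (-L, y) = 0 := fun y => hw_zero _ (Or.inl (by simp [le_abs_self]))
    simp [W, this]
  have hWr : W L = 0 := by
    have : ∀ y, w (L, y) = 0 := fun y => hw_zero _ (Or.inl (by simp [le_abs_self]))
    simp [W, this]
  have hf1n : ∀ x, 0 ≤ f1 x := fun x => intervalIntegral.integral_nonneg hLL fun y _ => sq_nonneg _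
  have hDn : ∀ x, 0 ≤ D x := fun x => intervalIntegral.integral_nonneg hLL fun y _ => Real.sqrt_nonneg _
  change 4 * Real.pi * (∫ x in (-L)..L, f1 x) ≤ (∫ x in (-L)..L, D x) ^ 2
  set A := ∫ x in (-L)..L, f1 x with hA
  have hA0 : 0 ≤ A := intervalIntegral.integral_nonneg hLL fun y _ => hf1n _
  have hpi := Real.pi_pos
  rcases eq_or_lt_of_le hA0 with h0 | hApos
  · rw [← h0]; simp only [mul_zero]; positivity
  have main : ∀ ε : ℝ, 0 < ε → ε < 1 → 4 * (Real.pi * (1 - ε)) * A ≤ (∫ x in (-L)..L, D x) ^ 2 := by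
    intro ε hε hε1
    obtain ⟨Th, hThc, hcos, hThd⟩ := fk_angle
    let F1 : ℝ → ℝ := fun x => ∫ z in (-L)..x, f1 z
    have hF1 : ∀ x, HasDerivAt F1 (f1 x) x := fun x =>
      (hf1c.integral_hasStrictDerivAt _ _).hasDerivAt
    let P : ℝ → ℝ := fun x => Real.pi * ((1 - ε) * (F1 x / A) + ε / 2 - 1 / 2)
    have hP : ∀ x, HasDerivAt P (Real.pi * ((1 - ε) * (f1 x / A))) x := fun x =>
      (((((hF1 x).div_const A).const_mul (1 - ε)).add_const (ε / 2)).sub_const (1 / 2)).const_mul Real.pi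
    have hPc : Continuous P := continuous_iff_continuousAt.2 fun y => (hP y).continuousAt
    have hPb : ∀ x ∈ Set.Icc (-L) L, |P x| < Real.pi / 2 := by
      intro x hx
      have hF0 : 0 ≤ F1 x := intervalIntegral.integral_nonneg hx.1 fun y _ => hf1n _
      have hF1 : F1 x ≤ A := by
        have : F1 x + ∫ z in x..L, f1 z = A :=
          intervalIntegral.integral_add_adjacent_intervals
            (hf1c.intervalIntegrable _ _) (hf1c.intervalIntegrable _ _)
        have h2 : 0 ≤ ∫ z in x..L, f1 z := intervalIntegral.integral_nonneg hx.2 fun y _ => hf1n _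
        linarith
      have h1 : 0 ≤ F1 x / A := by positivity
      have h2 : F1 x / A ≤ 1 := by rw [div_le_one hApos]; exact hF1
      have h3 : |(1 - ε) * (F1 x / A) + ε / 2 - 1 / 2| < 1 / 2 := by
        rw [abs_lt]; constructor <;> nlinarith
      simp only [P]
      rw [abs_mul, abs_of_pos hpi]
      nlinarith
    set c := Real.sqrt (Real.pi * (1 - ε) / A) with hcdef
    have hcsq : c ^ 2 = Real.pi * (1 - ε) / A := by
      rw [hcdef, Real.sq_sqrt]
      have : 0 < 1 - ε := by linarith
      positivity
    have hc0 : 0 ≤ c := Real.sqrt_nonneg _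
    let a : ℝ → ℝ := fun x => c ^ 2 * f1 x / (2 * Real.cos (Th (P x)))
    have hT1 : ∀ x ∈ Set.Icc (-L) L, HasDerivAt (fun x => Real.sin (Th (P x))) (a x) x := by
      intro x hx
      have hcp := hcos _ (hPb x hx)
      refine ((hThd _ (hPb x hx)).comp x (hP x)).sin.congr_deriv ?_
      simp only [a, Function.comp]
      rw [hcsq]
      field_simp
    have hac : ContinuousOn a (Set.Icc (-L) L) := by
      refine ContinuousOn.div (by fun_prop) (by fun_prop) ?_
      intro x hx
      have hcp := hcos _ (hPb x hx)
      positivity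
    have hWc : Continuous W := continuous_iff_continuousAt.2 fun y => (hWd y).continuousAt
    have huIcc : Set.uIcc (-L) L = Set.Icc (-L) L := Set.uIcc_of_le hLL
    have hi1 : IntervalIntegrable (fun x => Real.sin (Th (P x)) * X x) volume (-L) L :=
      (by fun_prop : Continuous _).intervalIntegrable _ _
    have hi2 : IntervalIntegrable (fun x => a x * W x) volume (-L) L := by
      apply ContinuousOn.intervalIntegrable
      rw [huIcc]
      exact hac.mul hWc.continuousOn
    have hzero : ∫ x in (-L)..L, (a x * W x + Real.sin (Th (P x)) * X x) = 0 := by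
      rw [intervalIntegral.integral_eq_sub_of_hasDerivAt (f := fun x => Real.sin (Th (P x)) * W x)
        (fun x hx => (hT1 x (huIcc ▸ hx)).mul (hWd x)) (hi2.add hi1)]
      simp [hWl, hWr]
    have hineq : ∫ x in (-L)..L, (2 * c * f1 x - (a x * W x + Real.sin (Th (P x)) * X x))
        ≤ ∫ x in (-L)..L, D x := by
      refine intervalIntegral.integral_mono_on hLL ?_ (hDc.intervalIntegrable _ _) ?_
      · exact ((hf1c.const_mul _).intervalIntegrable _ _).sub (hi2.add hi1)
      · intro x hx
        have := fk_slice L hL (fun y => w (x, y)) (fun y => wx (x, y)) (fun y => wy (x, y))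
          (hdy x) (by fun_prop) (by fun_prop) (fun y => hw0 _)
          (hw_zero _ (Or.inr (by simp [le_abs_self]))) (hw_zero _ (Or.inr (by simp [le_abs_self])))
          (f1 x) (a x) c (Th (P x)) rfl (hcos _ (hPb x hx)) hc0 rfl
        change - (Real.sin (Th (P x)) * X x) - a x * W x + 2 * c * f1 x ≤ D x at this
        linarith
    rw [intervalIntegral.integral_sub ((hf1c.const_mul _).intervalIntegrable _ _) (hi2.add hi1), hzero,
      intervalIntegral.integral_const_mul, ← hA, sub_zero] at hineq
    calc 4 * (Real.pi * (1 - ε)) * A = (2 * c * A) ^ 2 := by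
          rw [mul_pow, mul_pow, hcsq]; field_simp; ring
      _ ≤ _ := by gcongr
  refine le_of_forall_pos_sub_le ?_
  intro δ hδ
  set S := 4 * Real.pi * A with hS
  have hSpos : 0 < S := by positivity
  have := main (min (δ / S) (1 / 2)) (by positivity) (lt_of_le_of_lt (min_le_right _ _) (by norm_num))
  have h2 : min (δ / S) (1 / 2) * S ≤ δ := by
    calc _ ≤ δ / S * S := by gcongr; exact min_le_left _ _
      _ = δ := by field_simp
  have h3 : 4 * (Real.pi * (1 - min (δ / S) (1 / 2))) * A = S - min (δ / S) (1 / 2) * S := by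
    rw [hS]; ring
  linarith

lemma fk_discrete (M T S lam : ℝ) (q R mu E B : ℝ → ℝ) (hT : 0 < T) (hlam : 1 < lam) (hR0 : R 0 = 0)
    (hM : 0 ≤ M)
    (hq0 : ∀ m ∈ Set.Icc 0 M, 0 ≤ q m)
    (hqR : ∀ m' m, 0 ≤ m' → m' ≤ m → m ≤ M → q m' ^ 2 * (m - m') ≤ R m - R m')
    (hQ : ∀ m ∈ Set.Icc 0 M, 2 * Real.sqrt (Real.pi * m) * q m = lam * m + R m)
    (hmu : Antitone mu) (hmu0 : ∀ t, 0 ≤ mu t) (hmuM : ∀ t, mu t ≤ M)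
    (hmuT : mu T = 0) (hET : E T = 0) (hBT : B T = 0)
    (hE : ∀ h, 0 < h → E h ≤ S) (hB0 : B 0 = S)
    (hlayer : ∀ a b k, 0 < a → a < b → 0 ≤ k →
      2 * k * (2 * (b - a) * Real.sqrt (Real.pi * mu b)) - k ^ 2 * (mu a - mu b) ≤ E a - E b)
    (hB : ∀ a b, 0 ≤ a → a < b → B a - B b ≤ b ^ 2 * (mu a - mu b)) : lam * S ≤ S := by
  have hmem : ∀ t, mu t ∈ Set.Icc 0 M := fun t => ⟨hmu0 t, hmuM t⟩
  have hRmono : ∀ m' m, 0 ≤ m' → m' ≤ m → m ≤ M → R m' ≤ R m := by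
    intro m' m h0 h1 h2
    have := hqR m' m h0 h1 h2
    have h3 : 0 ≤ q m' ^ 2 * (m - m') := mul_nonneg (sq_nonneg _) (by linarith)
    linarith
  have hRM : ∀ t, R (mu t) ≤ R M := fun t => hRmono _ _ (hmu0 t) (hmuM t) le_rfl
  have hRn : ∀ t, 0 ≤ R (mu t) := fun t => by
    have := hRmono 0 (mu t) le_rfl (hmu0 t) (hmuM t)
    linarith
  set K := R M + 3 * lam * M with hK
  have hRM0 : 0 ≤ R M := (hRn 0).trans (hRM 0)
  have hK0 : 0 ≤ K := by positivity
  let Psi : ℝ → ℝ → ℝ := fun h t =>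
    E t + t ^ 2 * R (mu t) - lam * (B t - t ^ 2 * mu t - 2 * h * t * mu t)
  have step : ∀ h t, 0 < h → 0 < t → Psi h (t + h) - h ^ 2 * K ≤ Psi h t := by
    intro h t hh ht
    have h1 := hlayer t (t + h) (t * q (mu (t + h))) ht (by linarith)
      (mul_nonneg ht.le (hq0 _ (hmem _)))
    have h2 := hB t (t + h) ht.le (by linarith)
    have h3 := hqR (mu (t + h)) (mu t) (hmu0 _) (hmu (by linarith)) (hmuM _)
    have h4 := hQ (mu (t + h)) (hmem _)
    have h5 := hRM (t + h)
    have h6 := hmuM (t + h)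
    have h7 := hmuM t
    simp only [Psi]
    set m := mu t
    set m' := mu (t + h)
    have e1 : 2 * (t * q m') * (2 * (t + h - t) * Real.sqrt (Real.pi * m')) =
        2 * h * t * (lam * m' + R m') := by
      rw [← h4]; ring
    rw [e1, mul_pow] at h1
    have h8 : t ^ 2 * (q m' ^ 2 * (m - m')) ≤ t ^ 2 * (R m - R m') :=
      mul_le_mul_of_nonneg_left h3 (sq_nonneg _)
    have h9 : lam * (B t - B (t + h)) ≤ lam * ((t + h) ^ 2 * (m - m')) :=
      mul_le_mul_of_nonneg_left h2 (by linarith)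
    have h10 : h ^ 2 * (R m' + lam * (2 * m' + m)) ≤ h ^ 2 * K := by
      rw [hK]
      have : lam * (2 * m' + m) ≤ lam * (3 * M) :=
        mul_le_mul_of_nonneg_left (by linarith) (by linarith)
      refine mul_le_mul_of_nonneg_left ?_ (sq_nonneg _)
      linarith
    linarith
  have iter : ∀ h, 0 < h → ∀ n : ℕ, Psi h (h + n * h) - n * (h ^ 2 * K) ≤ Psi h h := by
    intro h hh n
    induction n with
    | zero => simp
    | succ n ih =>
      have := step h (h + n * h) hh (by positivity)
      have e : h + n * h + h = h + (n + 1 : ℕ) * h := by push_cast; ring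
      rw [e] at this
      push_cast at this ⊢
      linarith
  have fin : ∀ n : ℕ, lam * S - S ≤ (T ^ 2 * (K + lam * M + K)) / ((n : ℝ) + 1) := by
    intro n
    set h := T / ((n : ℝ) + 1) with hh
    have hn : (0:ℝ) < (n : ℝ) + 1 := by positivity
    have hpos : 0 < h := by positivity
    have hTn : h + n * h = T := by rw [hh]; field_simp; ring
    have h1 := iter h hpos n
    rw [hTn] at h1
    simp only [Psi, hET, hmuT, hBT, hR0] at h1
    have h2 := hE h hpos
    have h3 := hB 0 h le_rfl hpos
    rw [hB0] at h3
    have h4 := hRM h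
    have h5 := hmuM h
    have h6 := hmuM 0
    have h7 := hmu0 h
    have h8 : lam * (S - B h) ≤ lam * (h ^ 2 * M) := by
      refine mul_le_mul_of_nonneg_left (h3.trans ?_) (by linarith)
      refine mul_le_mul_of_nonneg_left (by linarith) (sq_nonneg _)
    have h9 : h ^ 2 * R (mu h) + lam * (h ^ 2 * mu h + 2 * h * h * mu h) ≤ h ^ 2 * K := by
      rw [hK]
      have : lam * mu h ≤ lam * M := mul_le_mul_of_nonneg_left h5 (by linarith)
      have : h ^ 2 * (R (mu h) + 3 * (lam * mu h)) ≤ h ^ 2 * (R M + 3 * lam * M) :=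
        mul_le_mul_of_nonneg_left (by linarith) (sq_nonneg _)
      linarith
    have h10 : n * (h ^ 2 * K) ≤ T * h * K := by
      have : n * h ≤ T := by linarith
      have : (n * h) * (h * K) ≤ T * (h * K) := mul_le_mul_of_nonneg_right this (by positivity)
      linarith
    have hhT : h ≤ T := by
      have : 0 ≤ n * h := by positivity
      linarith
    have h11 : h ^ 2 * (K + lam * M) ≤ T * h * (K + lam * M) := by
      have : h ^ 2 ≤ T * h := by nlinarith
      exact mul_le_mul_of_nonneg_right this (by positivity)
    have h12 : (T ^ 2 * (K + lam * M + K)) / ((n : ℝ) + 1) = T * h * (K + lam * M) + T * h * K := by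
      rw [hh]; field_simp
    rw [h12]
    linarith
  have hlim : Filter.Tendsto (fun n : ℕ => (T ^ 2 * (K + lam * M + K)) / ((n : ℝ) + 1)) Filter.atTop (nhds 0) := by
    have := (tendsto_const_div_atTop_nhds_zero_nat (T ^ 2 * (K + lam * M + K))).comp
      (Filter.tendsto_add_atTop_nat 1)
    refine this.congr fun n => ?_
    simp
  have := ge_of_tendsto' hlim fin
  linarith

lemma fk_cutoff (Om : Set (ℝ × ℝ)) (hO : IsOpen Om) (hb : Bornology.IsBounded Om)
    (f : ℝ × ℝ → ℝ) (hf : ContDiff ℝ 2 f) (hfr : ∀ p ∈ closure Om, p ∉ Om → f p = 0)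
    (ψ : ℝ → ℝ) (hψ : Continuous ψ) (a : ℝ) (ha : 0 < a) (hψa : ∀ t ≤ a, ψ t = 0) :
    ∃ w : ℝ × ℝ → ℝ, ContDiff ℝ 1 w ∧ HasCompactSupport w ∧
      (∀ p ∈ Om, w p = ∫ z in (0:ℝ)..(f p), ψ z) ∧ (∀ p ∉ Om, w p = 0) ∧
      (∀ p ∈ Om, fderiv ℝ w p = ψ (f p) • fderiv ℝ f p) ∧ (∀ p ∉ Om, fderiv ℝ w p = 0) := by
  classical
  let φ : ℝ → ℝ := fun t => ∫ z in (0:ℝ)..t, ψ z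
  have hφd : ∀ t, HasDerivAt φ (ψ t) t := fun t => (hψ.integral_hasStrictDerivAt _ _).hasDerivAt
  have hφ : ContDiff ℝ 1 φ := by
    rw [contDiff_one_iff_deriv]
    refine ⟨fun t => (hφd t).differentiableAt, ?_⟩
    have : deriv φ = ψ := funext fun t => (hφd t).deriv
    rw [this]; exact hψ
  have hφ0 : ∀ t ≤ a, φ t = 0 := by
    intro t ht
    simp only [φ]
    have : ∀ z ∈ Set.uIcc 0 t, ψ z = 0 := by
      intro z hz
      apply hψa
      have := hz.2
      exact this.trans (max_le ha.le ht)
    rw [intervalIntegral.integral_congr (g := fun _ => (0:ℝ)) this]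
    simp
  let K : Set (ℝ × ℝ) := closure Om ∩ {p | a ≤ f p}
  have hKcl : IsClosed K := isClosed_closure.inter (isClosed_le continuous_const hf.continuous)
  have hKc : IsCompact K := hb.isCompact_closure.inter_right (isClosed_le continuous_const hf.continuous)
  have hKO : K ⊆ Om := by
    rintro p ⟨h1, h2⟩
    by_contra h
    have := hfr p h1 h
    simp only [Set.mem_ofPred_eq] at h2
    linarith
  let w : ℝ × ℝ → ℝ := fun p => if p ∈ Om then φ (f p) else 0
  have hw1 : ∀ p ∈ Om, w =ᶠ[nhds p] (φ ∘ f) := by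
    intro p hp
    filter_upwards [hO.mem_nhds hp] with x hx
    simp [w, hx]
  have hw0 : ∀ p ∉ K, w p = 0 := by
    intro p hp
    by_cases hpO : p ∈ Om
    · have : f p ≤ a := by
        by_contra h
        exact hp ⟨subset_closure hpO, (not_le.1 h).le⟩
      simp [w, hφ0 _ this]
    · simp [w, hpO]
  have hw2 : ∀ p ∉ K, w =ᶠ[nhds p] (fun _ => 0) := by
    intro p hp
    filter_upwards [hKcl.isOpen_compl.mem_nhds hp] with x hx
    exact hw0 x hx
  have hf1 : ContDiff ℝ 1 f := hf.of_le (by norm_num)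
  refine ⟨w, ?_, ?_, ?_, ?_, ?_, ?_⟩
  · rw [contDiff_iff_contDiffAt]
    intro p
    by_cases hp : p ∈ K
    · exact (hφ.comp hf1).contDiffAt.congr_of_eventuallyEq (hw1 p (hKO hp))
    · exact contDiffAt_const.congr_of_eventuallyEq (hw2 p hp)
  · refine HasCompactSupport.intro hKc hw0
  · intro p hp; simp [w, hp, φ]
  · intro p hp; simp [w, hp]
  · intro p hp
    rw [(hw1 p hp).fderiv_eq]
    have := (hφd (f p)).comp_hasFDerivAt p ((hf1.differentiable (by norm_num)) p).hasFDerivAt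
    exact this.fderiv
  · intro p hp
    have : p ∉ K := fun h => hp (hKO h)
    rw [(hw2 p this).fderiv_eq]
    simp

lemma fk_layer (Om : Set (ℝ × ℝ)) (hO : IsOpen Om) (hb : Bornology.IsBounded Om)
    (f : ℝ × ℝ → ℝ) (hf : ContDiff ℝ 2 f) (hfr : ∀ p ∈ closure Om, p ∉ Om → f p = 0)
    (a b : ℝ) (ha : 0 < a) (hab : a < b) :
    2 * (b - a) * Real.sqrt (Real.pi * volume.real (Om ∩ {p | b < f p})) ≤
      ∫ p in Om ∩ {p | a < f p ∧ f p ≤ b},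
        Real.sqrt (fderiv ℝ f p (1, 0) ^ 2 + fderiv ℝ f p (0, 1) ^ 2) := by
  set m := volume.real (Om ∩ {p | b < f p}) with hm
  have hm0 : 0 ≤ m := measureReal_nonneg
  set N : ℝ × ℝ → ℝ := fun p => Real.sqrt (fderiv ℝ f p (1, 0) ^ 2 + fderiv ℝ f p (0, 1) ^ 2) with hN
  have hfd : Continuous (fderiv ℝ f) := hf.continuous_fderiv (by norm_num)
  have hfc := hf.continuous
  have hNc : Continuous N := by fun_prop
  have hfin : volume Om ≠ ⊤ := hb.measure_lt_top.ne
  have hNint : IntegrableOn N Om := by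
    have : IntegrableOn N (closure Om) := hNc.continuousOn.integrableOn_compact hb.isCompact_closure
    exact this.mono_set subset_closure
  have hmeas : MeasurableSet (Om ∩ {p | a < f p ∧ f p ≤ b}) :=
    hO.measurableSet.inter ((measurableSet_lt measurable_const hfc.measurable).inter
      (measurableSet_le hfc.measurable measurable_const))
  have hmeasb : MeasurableSet (Om ∩ {p | b < f p}) :=
    hO.measurableSet.inter (measurableSet_lt measurable_const hfc.measurable)
  have main : ∀ δ : ℝ, 0 < δ → 2 * δ < b - a →
      2 * (b - a - 2 * δ) * Real.sqrt (Real.pi * m) ≤ ∫ p in Om ∩ {p | a < f p ∧ f p ≤ b}, N p := by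
    intro δ hδ hδ2
    let ψ : ℝ → ℝ := fun t => max 0 (min 1 (min ((t - a) / δ) ((b - t) / δ)))
    have hψc : Continuous ψ := by fun_prop
    have hψ0 : ∀ t, 0 ≤ ψ t := fun t => le_max_left _ _
    have hψ1 : ∀ t, ψ t ≤ 1 := fun t => max_le zero_le_one (min_le_left _ _)
    have hψa : ∀ t ≤ a, ψ t = 0 := by
      intro t ht
      apply max_eq_left
      refine (min_le_right _ _).trans ((min_le_left _ _).trans ?_)
      exact div_nonpos_of_nonpos_of_nonneg (by linarith) hδ.le
    have hψb : ∀ t, b ≤ t → ψ t = 0 := by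
      intro t ht
      apply max_eq_left
      refine (min_le_right _ _).trans ((min_le_right _ _).trans ?_)
      exact div_nonpos_of_nonpos_of_nonneg (by linarith) hδ.le
    have hψm : ∀ t, a + δ ≤ t → t ≤ b - δ → 1 ≤ ψ t := by
      intro t h1 h2
      refine le_max_of_le_right (le_min le_rfl (le_min ?_ ?_))
      · rw [one_le_div hδ]; linarith
      · rw [one_le_div hδ]; linarith
    have hinteg : ∀ x y, IntervalIntegrable ψ volume x y := fun x y => hψc.intervalIntegrable _ _
    have hφb : ∀ t, b < t → b - a - 2 * δ ≤ ∫ z in (0:ℝ)..t, ψ z := by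
      intro t ht
      have e1 : ∫ z in (0:ℝ)..t, ψ z = (∫ z in (0:ℝ)..(a + δ), ψ z) + (∫ z in (a + δ)..(b - δ), ψ z)
          + ∫ z in (b - δ)..t, ψ z := by
        rw [intervalIntegral.integral_add_adjacent_intervals (hinteg _ _) (hinteg _ _),
          intervalIntegral.integral_add_adjacent_intervals (hinteg _ _) (hinteg _ _)]
      have h1 : 0 ≤ ∫ z in (0:ℝ)..(a + δ), ψ z :=
        intervalIntegral.integral_nonneg (by linarith) fun z _ => hψ0 z
      have h2 : 0 ≤ ∫ z in (b - δ)..t, ψ z :=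
        intervalIntegral.integral_nonneg (by linarith) fun z _ => hψ0 z
      have h3 : ∫ z in (a + δ)..(b - δ), (1:ℝ) ≤ ∫ z in (a + δ)..(b - δ), ψ z :=
        intervalIntegral.integral_mono_on (by linarith) (by simp) (hinteg _ _) fun z hz => hψm z hz.1 hz.2
      simp at h3
      linarith
    have hφ0 : ∀ t, 0 ≤ t → 0 ≤ ∫ z in (0:ℝ)..t, ψ z := fun t ht =>
      intervalIntegral.integral_nonneg ht fun z _ => hψ0 z
    obtain ⟨w, hw, hwcs, hwO, hwn, hdO, hdn⟩ := fk_cutoff Om hO hb f hf hfr ψ hψc a ha hψa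
    have hw0 : ∀ p, 0 ≤ w p := by
      intro p
      by_cases hp : p ∈ Om
      · rw [hwO p hp]
        rcases le_total 0 (f p) with h | h
        · exact hφ0 _ h
        · rw [intervalIntegral.integral_symm, intervalIntegral.integral_congr (g := fun _ => (0:ℝ))]
          · simp
          · intro z hz
            rw [Set.uIcc_of_le h] at hz
            exact hψa z (hz.2.trans ha.le)
      · rw [hwn p hp]
    have hsob := fk_sobolev w hw hwcs hw0
    have hgrad : ∫ p, Real.sqrt (fderiv ℝ w p (1, 0) ^ 2 + fderiv ℝ w p (0, 1) ^ 2)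
        ≤ ∫ p in Om ∩ {p | a < f p ∧ f p ≤ b}, N p := by
      rw [← MeasureTheory.integral_indicator hmeas]
      refine integral_mono_of_nonneg (Filter.Eventually.of_forall fun p => Real.sqrt_nonneg _) ?_ ?_
      · exact (integrable_indicator_iff hmeas).2 (hNint.mono_set Set.inter_subset_left)
      · refine Filter.Eventually.of_forall fun p => ?_
        have hnn : 0 ≤ (Om ∩ {p | a < f p ∧ f p ≤ b}).indicator N p :=
          Set.indicator_nonneg (fun p _ => Real.sqrt_nonneg _) p
        by_cases hp : p ∈ Om
        · simp only [hdO p hp]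
          by_cases hp2 : a < f p ∧ f p ≤ b
          · rw [Set.indicator_of_mem (show p ∈ Om ∩ {p | a < f p ∧ f p ≤ b} from ⟨hp, hp2⟩)]
            simp only [hN, smul_apply, smul_eq_mul]
            apply Real.sqrt_le_sqrt
            rw [mul_pow, mul_pow]
            have : ψ (f p) ^ 2 ≤ 1 := pow_le_one₀ (hψ0 _) (hψ1 _)
            nlinarith [sq_nonneg (fderiv ℝ f p (1, 0)), sq_nonneg (fderiv ℝ f p (0, 1))]
          · have : ψ (f p) = 0 := by
              rw [not_and_or, not_lt, not_le] at hp2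
              rcases hp2 with h | h
              · exact hψa _ h
              · exact hψb _ h.le
            simpa [this] using hnn
        · simpa [hdn p hp] using hnn
    have hsq : (b - a - 2 * δ) ^ 2 * m ≤ ∫ p, w p ^ 2 := by
      have hc : (b - a - 2 * δ) ^ 2 * m = ∫ p in Om ∩ {p | b < f p}, (b - a - 2 * δ) ^ 2 := by
        rw [setIntegral_const, smul_eq_mul, hm]; ring
      rw [hc, ← MeasureTheory.integral_indicator hmeasb]
      have hwint : Integrable (fun p => w p ^ 2) := by
        have := hw.continuous
        refine (by fun_prop : Continuous fun p => w p ^ 2).integrable_of_hasCompactSupport ?_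
        exact hwcs.comp_left (g := fun x => x ^ 2) (by simp)
      refine integral_mono_of_nonneg (Filter.Eventually.of_forall fun p =>
        Set.indicator_nonneg (fun p _ => sq_nonneg _) p) hwint (Filter.Eventually.of_forall fun p => ?_)
      by_cases hp : p ∈ Om ∩ {p | b < f p}
      swap
      · simp only [Set.indicator_of_notMem hp]; exact sq_nonneg _
      simp only [Set.indicator_of_mem hp]
      rw [hwO p hp.1]
      have := hφb (f p) hp.2
      have h0 : 0 ≤ b - a - 2 * δ := by linarith
      gcongr
    have hI0 : 0 ≤ ∫ p, Real.sqrt (fderiv ℝ w p (1, 0) ^ 2 + fderiv ℝ w p (0, 1) ^ 2) :=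
      integral_nonneg fun p => Real.sqrt_nonneg _
    refine le_trans ?_ hgrad
    have hpi := Real.pi_pos
    refine (sq_le_sq₀ ?_ hI0).1 ?_
    · have h0 : 0 ≤ b - a - 2 * δ := by linarith
      positivity
    · rw [mul_pow, Real.sq_sqrt (by positivity)]
      refine le_trans ?_ hsob
      nlinarith
  set I := ∫ p in Om ∩ {p | a < f p ∧ f p ≤ b}, N p
  have hlim : Filter.Tendsto (fun δ : ℝ => 2 * (b - a - 2 * δ) * Real.sqrt (Real.pi * m)) (nhdsWithin 0 (Set.Ioi 0))
      (nhds (2 * (b - a - 2 * 0) * Real.sqrt (Real.pi * m))) := by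
    refine Filter.Tendsto.mono_left ?_ nhdsWithin_le_nhds
    exact (by fun_prop : Continuous fun δ : ℝ => 2 * (b - a - 2 * δ) * Real.sqrt (Real.pi * m)).tendsto 0
  have : 2 * (b - a - 2 * 0) * Real.sqrt (Real.pi * m) ≤ I := by
    refine le_of_tendsto hlim ?_
    have : Set.Ioo 0 ((b - a) / 2) ∈ nhdsWithin (0:ℝ) (Set.Ioi 0) := Ioo_mem_nhdsGT (by linarith)
    filter_upwards [this] with δ hδ
    exact main δ hδ.1 (by linarith [hδ.2])
  simpa using this

lemma fk_energy (Om : Set (ℝ × ℝ)) (hO : IsOpen Om) (hb : Bornology.IsBounded Om)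
    (f : ℝ × ℝ → ℝ) (hf : ContDiff ℝ 2 f) (hfr : ∀ p ∈ closure Om, p ∉ Om → f p = 0)
    (hpos : ∀ p ∈ Om, 0 < f p)
    (hpde : ∀ p, fderiv ℝ (fun p => fderiv ℝ f p (1, 0)) p (1, 0) +
      fderiv ℝ (fun p => fderiv ℝ f p (0, 1)) p (0, 1) + f p = 0)
    (h : ℝ) (hh : 0 < h) :
    ∫ p in Om ∩ {p | h < f p}, (fderiv ℝ f p (1, 0) ^ 2 + fderiv ℝ f p (0, 1) ^ 2) ≤
      ∫ p in Om, f p ^ 2 := by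
  let a := h / 2
  have ha : 0 < a := by positivity
  let ψ : ℝ → ℝ := fun t => max 0 (min 1 ((t - a) / a))
  have hψc : Continuous ψ := by fun_prop
  have hψ0 : ∀ t, 0 ≤ ψ t := fun t => le_max_left _ _
  have hψ1 : ∀ t, ψ t ≤ 1 := fun t => max_le zero_le_one (min_le_left _ _)
  have hψa : ∀ t ≤ a, ψ t = 0 := by
    intro t ht
    apply max_eq_left
    refine (min_le_right _ _).trans ?_
    exact div_nonpos_of_nonpos_of_nonneg (by linarith) ha.le
  have hψh : ∀ t, h < t → 1 ≤ ψ t := by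
    intro t h1
    refine le_max_of_le_right (le_min le_rfl ?_)
    rw [one_le_div ha]; simp only [a]; linarith
  obtain ⟨w, hw, hwcs, hwO, hwn, hdO, hdn⟩ := fk_cutoff Om hO hb f hf hfr ψ hψc a ha hψa
  have hfd : Continuous (fderiv ℝ f) := hf.continuous_fderiv (by norm_num)
  have hfc := hf.continuous
  have hwc := hw.continuous
  have hwd : Continuous (fderiv ℝ w) := hw.continuous_fderiv (by norm_num)
  have hwdcs : HasCompactSupport (fderiv ℝ w) := hwcs.fderiv ℝ
  have hfd1 : ContDiff ℝ 1 (fderiv ℝ f) := hf.fderiv_right (by norm_num)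
  have hparts : ∀ v : ℝ × ℝ, Integrable (fun p => w p * fderiv ℝ (fun p => fderiv ℝ f p v) p v) ∧
      Integrable (fun p => fderiv ℝ w p v * fderiv ℝ f p v) ∧
      ∫ p, w p * fderiv ℝ (fun p => fderiv ℝ f p v) p v = - ∫ p, fderiv ℝ w p v * fderiv ℝ f p v := by
    intro v
    have hg : ContDiff ℝ 1 (fun p => fderiv ℝ f p v) := hfd1.clm_apply contDiff_const
    have hgc : Continuous (fderiv ℝ (fun p => fderiv ℝ f p v)) := hg.continuous_fderiv (by norm_num)
    have i1 : Integrable (fun p => w p * fderiv ℝ (fun p => fderiv ℝ f p v) p v) :=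
      (by fun_prop : Continuous _).integrable_of_hasCompactSupport hwcs.mul_right
    have i2 : Integrable (fun p => fderiv ℝ w p v * fderiv ℝ f p v) := by
      refine (by fun_prop : Continuous _).integrable_of_hasCompactSupport (HasCompactSupport.mul_right ?_)
      exact hwdcs.comp_left (g := fun l : (ℝ × ℝ) →L[ℝ] ℝ => l v) (by simp)
    have i3 : Integrable (fun p => w p * fderiv ℝ f p v) :=
      (by fun_prop : Continuous _).integrable_of_hasCompactSupport hwcs.mul_right
    refine ⟨i1, i2, ?_⟩
    exact integral_mul_fderiv_eq_neg_fderiv_mul_of_integrable i2 i1 i3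
      (fun p _ => (hw.differentiable (by norm_num)) p) (fun p _ => (hg.differentiable (by norm_num)) p)
  obtain ⟨a1, a2, a3⟩ := hparts (1, 0)
  obtain ⟨b1, b2, b3⟩ := hparts (0, 1)
  have hid : ∫ p, (fderiv ℝ w p (1, 0) * fderiv ℝ f p (1, 0) + fderiv ℝ w p (0, 1) * fderiv ℝ f p (0, 1))
      = ∫ p, w p * f p := by
    rw [MeasureTheory.integral_add a2 b2]
    have : ∫ p, w p * f p = - ((∫ p, w p * fderiv ℝ (fun p => fderiv ℝ f p (1, 0)) p (1, 0)) +
        ∫ p, w p * fderiv ℝ (fun p => fderiv ℝ f p (0, 1)) p (0, 1)) := by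
      rw [← MeasureTheory.integral_add a1 b1, ← MeasureTheory.integral_neg]
      congr 1
      funext p
      linear_combination w p * hpde p
    rw [this, a3, b3]; ring
  have hmeas : MeasurableSet (Om ∩ {p | h < f p}) :=
    hO.measurableSet.inter (measurableSet_lt measurable_const hfc.measurable)
  have h1 : ∫ p in Om ∩ {p | h < f p}, (fderiv ℝ f p (1, 0) ^ 2 + fderiv ℝ f p (0, 1) ^ 2) ≤
      ∫ p, (fderiv ℝ w p (1, 0) * fderiv ℝ f p (1, 0) + fderiv ℝ w p (0, 1) * fderiv ℝ f p (0, 1)) := by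
    rw [← MeasureTheory.integral_indicator hmeas]
    refine integral_mono_of_nonneg (Filter.Eventually.of_forall fun p =>
      Set.indicator_nonneg (fun p _ => by positivity) p) (a2.add b2) (Filter.Eventually.of_forall fun p => ?_)
    have hnn : 0 ≤ fderiv ℝ w p (1, 0) * fderiv ℝ f p (1, 0) + fderiv ℝ w p (0, 1) * fderiv ℝ f p (0, 1) := by
      by_cases hp : p ∈ Om
      · simp only [hdO p hp, smul_apply, smul_eq_mul]
        have := hψ0 (f p)
        nlinarith [mul_nonneg this (sq_nonneg (fderiv ℝ f p (1, 0))), mul_nonneg this (sq_nonneg (fderiv ℝ f p (0, 1)))]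
      · simp [hdn p hp]
    by_cases hp : p ∈ Om ∩ {p | h < f p}
    · rw [Set.indicator_of_mem hp]
      simp only [hdO p hp.1, smul_apply, smul_eq_mul]
      have := hψh (f p) hp.2
      nlinarith [sq_nonneg (fderiv ℝ f p (1, 0)), sq_nonneg (fderiv ℝ f p (0, 1))]
    · rw [Set.indicator_of_notMem hp]; exact hnn
  have h2 : ∫ p, w p * f p ≤ ∫ p in Om, f p ^ 2 := by
    rw [← MeasureTheory.integral_indicator hO.measurableSet]
    have hinteg : IntegrableOn (fun p => f p ^ 2) Om := by
      have : IntegrableOn (fun p => f p ^ 2) (closure Om) :=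
        (by fun_prop : Continuous fun p => f p ^ 2).continuousOn.integrableOn_compact hb.isCompact_closure
      exact this.mono_set subset_closure
    refine integral_mono ((by fun_prop : Continuous _).integrable_of_hasCompactSupport hwcs.mul_right)
      ((integrable_indicator_iff hO.measurableSet).2 hinteg) ?_
    intro p
    by_cases hp : p ∈ Om
    · simp only [Set.indicator_of_mem hp]
      have hfp := hpos p hp
      have : w p ≤ f p := by
        rw [hwO p hp]
        have := intervalIntegral.integral_mono_on hfp.le (hψc.intervalIntegrable _ _)
          (intervalIntegrable_const : IntervalIntegrable (fun _ => (1:ℝ)) volume 0 (f p)) (fun z _ => hψ1 z)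
        simpa using this
      nlinarith
    · simp [hwn p hp, hp]
  exact h1.trans (hid.le.trans h2)

lemma fk_core (Om : Set (ℝ × ℝ)) (hO : IsOpen Om) (hb : Bornology.IsBounded Om) (hne : Om.Nonempty)
    (f : ℝ × ℝ → ℝ) (hf : ContDiff ℝ 2 f) (hfr : ∀ p ∈ closure Om, p ∉ Om → f p = 0)
    (hpos : ∀ p ∈ Om, 0 < f p)
    (hpde : ∀ p, fderiv ℝ (fun p => fderiv ℝ f p (1, 0)) p (1, 0) +
      fderiv ℝ (fun p => fderiv ℝ f p (0, 1)) p (0, 1) + f p = 0) :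
    Real.pi * besselJZero 0 1 ^ 2 ≤ volume.real Om := by
  by_contra hcon
  rw [not_le] at hcon
  have hfc := hf.continuous
  have hfd : Continuous (fderiv ℝ f) := hf.continuous_fderiv (by norm_num)
  have hOfin : volume Om ≠ ⊤ := hb.measure_lt_top.ne
  have hcomp : IsCompact (closure Om) := hb.isCompact_closure
  have hinteg : ∀ g : ℝ × ℝ → ℝ, Continuous g → IntegrableOn g Om := fun g hg =>
    (hg.continuousOn.integrableOn_compact hcomp).mono_set subset_closure
  obtain ⟨lam, q, R, hlam, hR0, hq0, hqR, hQ⟩ := fk_comparison (volume.real Om) measureReal_nonneg hcon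
  let U : ℝ → Set (ℝ × ℝ) := fun t => Om ∩ {p | t < f p}
  have hUm : ∀ t, MeasurableSet (U t) := fun t =>
    hO.measurableSet.inter (measurableSet_lt measurable_const hfc.measurable)
  have hUO : ∀ t, U t ⊆ Om := fun t => Set.inter_subset_left
  have hUmono : ∀ a b, a ≤ b → U b ⊆ U a := fun a b hab p hp => ⟨hp.1, lt_of_le_of_lt hab hp.2⟩
  have hUfin : ∀ t, volume (U t) ≠ ⊤ := fun t => measure_ne_top_of_subset (hUO t) hOfin
  have hdiff : ∀ a b, U a \ U b = Om ∩ {p | a < f p ∧ f p ≤ b} := by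
    intro a b
    ext p
    simp only [U, Set.mem_sdiff, Set.mem_inter_iff, Set.mem_ofPred_eq, not_and, not_lt]
    tauto
  obtain ⟨T0, hT0⟩ := (hcomp.image hfc).bddAbove
  let T := max T0 1
  have hT : 0 < T := lt_of_lt_of_le one_pos (le_max_right _ _)
  have hfT : ∀ p ∈ Om, f p ≤ T := fun p hp =>
    (hT0 ⟨p, subset_closure hp, rfl⟩).trans (le_max_left _ _)
  have hUT : U T = ∅ := by
    ext p
    simp only [U, Set.mem_inter_iff, Set.mem_ofPred_eq, Set.mem_empty_iff_false, iff_false, not_and, not_lt]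
    exact hfT p
  have hU0 : U 0 = Om := by
    ext p
    simp only [U, Set.mem_inter_iff, Set.mem_ofPred_eq, and_iff_left_iff_imp]
    exact hpos p
  let G : ℝ × ℝ → ℝ := fun p => fderiv ℝ f p (1, 0) ^ 2 + fderiv ℝ f p (0, 1) ^ 2
  have hG : Continuous G := by fun_prop
  have hN : Continuous (fun p => Real.sqrt (G p)) := hG.sqrt
  have hmudiff : ∀ a b, a ≤ b → volume.real (U a \ U b) = volume.real (U a) - volume.real (U b) :=
    fun a b hab => measureReal_diff (hUmono a b hab) (hUm b)
  have hidiff : ∀ g : ℝ × ℝ → ℝ, Continuous g → ∀ a b, a ≤ b →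
      ∫ p in U a \ U b, g p = (∫ p in U a, g p) - ∫ p in U b, g p := fun g hg a b hab =>
    integral_diff (hUm b) ((hinteg g hg).mono_set (hUO a)) (hUmono a b hab)
  have hS : 0 < ∫ p in Om, f p ^ 2 := by
    rw [setIntegral_pos_iff_support_of_nonneg_ae (Filter.Eventually.of_forall fun p => sq_nonneg _)
      (hinteg _ (by fun_prop))]
    have : (Function.support fun p => f p ^ 2) ∩ Om = Om := by
      apply Set.inter_eq_right.2
      intro p hp
      simpa using (hpos p hp).ne'
    rw [this]
    exact hO.measure_pos _ hne
  have := fk_discrete (volume.real Om) T (∫ p in Om, f p ^ 2) lam q R (fun t => volume.real (U t))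
    (fun t => ∫ p in U t, G p) (fun t => ∫ p in U t, f p ^ 2) hT hlam hR0 measureReal_nonneg hq0 hqR hQ
    (fun a b hab => measureReal_mono (hUmono a b hab) (hUfin a)) (fun t => measureReal_nonneg)
    (fun t => measureReal_mono (hUO t) hOfin) (by simp [hUT]) (by simp [hUT]) (by simp [hUT])
    (fun h hh => fk_energy Om hO hb f hf hfr hpos hpde h hh) (by simp only [hU0]) ?_ ?_
  · nlinarith
  · intro a b k ha hab hk
    have h1 := fk_layer Om hO hb f hf hfr a b ha hab
    rw [← hdiff] at h1
    rw [← hmudiff a b hab.le, ← hidiff G hG a b hab.le]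
    have hsub : U a \ U b ⊆ Om := Set.sdiff_subset.trans (hUO a)
    have h2 : ∫ p in U a \ U b, (2 * k * Real.sqrt (G p) - k ^ 2) ≤ ∫ p in U a \ U b, G p := by
      refine setIntegral_mono ((hinteg _ (by fun_prop)).mono_set hsub) ((hinteg _ hG).mono_set hsub) fun p => ?_
      have h0 : 0 ≤ G p := by positivity
      have := Real.sq_sqrt h0
      nlinarith [sq_nonneg (Real.sqrt (G p) - k)]
    rw [MeasureTheory.integral_sub ((hinteg _ (by fun_prop)).mono_set hsub) ((hinteg _ (by fun_prop)).mono_set hsub),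
      MeasureTheory.integral_const_mul, setIntegral_const, smul_eq_mul] at h2
    have h3 := mul_le_mul_of_nonneg_left h1 (by positivity : 0 ≤ 2 * k)
    change 2 * k * (2 * (b - a) * Real.sqrt (Real.pi * volume.real (U b))) ≤
      2 * k * ∫ p in U a \ U b, Real.sqrt (G p) at h3
    linarith
  · intro a b ha hab
    have hsub : U a \ U b ⊆ Om := Set.sdiff_subset.trans (hUO a)
    rw [← hmudiff a b hab.le, ← hidiff (fun p => f p ^ 2) (by fun_prop) a b hab.le]
    have h2 : ∫ p in U a \ U b, f p ^ 2 ≤ ∫ p in U a \ U b, b ^ 2 := by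
      refine setIntegral_mono_on ((hinteg _ (by fun_prop)).mono_set hsub)
        ((hinteg _ (by fun_prop)).mono_set hsub) ((hUm a).diff (hUm b)) fun p hp => ?_
      rw [hdiff] at hp
      exact pow_le_pow_left₀ (hpos p hp.1).le hp.2.2 2
    rw [setIntegral_const, smul_eq_mul] at h2
    linarith

lemma fk_component (F : EuclideanSpace ℝ (Fin 2) → ℝ) (hF : ContDiff ℝ 2 F)
    (hEq : ∀ x, laplacian F x + F x = 0) (C : Set (EuclideanSpace ℝ (Fin 2))) (hO : IsOpen C)
    (hb : Bornology.IsBounded C) (hne : C.Nonempty) (hpos : ∀ x ∈ C, 0 < F x)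
    (hfr : ∀ x ∈ closure C, x ∉ C → F x = 0) :
    Real.pi * besselJZero 0 1 ^ 2 ≤ volume.real C := by
  let e : (ℝ × ℝ) ≃L[ℝ] EuclideanSpace ℝ (Fin 2) :=
    (ContinuousLinearEquiv.finTwoArrow ℝ ℝ).symm.trans (EuclideanSpace.equiv (Fin 2) ℝ).symm
  have he10 : e (1, 0) = EuclideanSpace.single 0 1 := by
    ext i; fin_cases i <;> simp [e]
  have he01 : e (0, 1) = EuclideanSpace.single 1 1 := by
    ext i; fin_cases i <;> simp [e]
  have hvp : MeasurePreserving e volume volume := by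
    have h1 := (volume_preserving_finTwoArrow ℝ).symm
    have h2 := PiLp.volume_preserving_toLp (Fin 2)
    exact h2.comp h1
  have hvol : volume.real C = volume.real (e ⁻¹' C) := by
    rw [measureReal_def, measureReal_def, hvp.measure_preimage hO.measurableSet.nullMeasurableSet]
  rw [hvol]
  have hd : ∀ p v, fderiv ℝ (F ∘ e) p v = fderiv ℝ F (e p) (e v) := by
    intro p v
    rw [e.comp_right_fderiv]; rfl
  refine fk_core (e ⁻¹' C) (hO.preimage e.continuous) ?_ ?_ (F ∘ e) (hF.comp e.contDiff) ?_ ?_ ?_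
  · have := e.symm.lipschitz.isBounded_image hb
    rwa [← e.image_symm_eq_preimage]
  · exact hne.preimage e.surjective
  · intro p hp hn
    refine hfr (e p) ?_ hn
    exact e.continuous.closure_preimage_subset C hp
  · intro p hp; exact hpos _ hp
  · intro p
    have h2 : ∀ v, fderiv ℝ (fun p => fderiv ℝ (F ∘ e) p v) p v =
        fderiv ℝ (fun y => fderiv ℝ F y (e v)) (e p) (e v) := by
      intro v
      have : (fun p => fderiv ℝ (F ∘ e) p v) = (fun y => fderiv ℝ F y (e v)) ∘ e := by
        funext p; exact hd p v
      rw [this, e.comp_right_fderiv]; rfl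
    rw [h2, h2, he10, he01]
    have := hEq (e p)
    rw [laplacian, Fin.sum_univ_two] at this
    exact this

lemma fk_nodal (F : EuclideanSpace ℝ (Fin 2) → ℝ) (hF : ContDiff ℝ 2 F)
    (hEq : ∀ x, laplacian F x + F x = 0) (x : EuclideanSpace ℝ (Fin 2)) (hx : F x ≠ 0)
    (hb : Bornology.IsBounded (connectedComponentIn {y | F y ≠ 0} x)) :
    Real.pi * besselJZero 0 1 ^ 2 ≤ volume.real (connectedComponentIn {y | F y ≠ 0} x) := by
  set Z := {y | F y ≠ 0} with hZ
  have hZo : IsOpen Z := isOpen_ne_fun hF.continuous continuous_const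
  set C := connectedComponentIn Z x with hC
  have hxC : x ∈ C := mem_connectedComponentIn hx
  have hO : IsOpen C := hZo.connectedComponentIn
  have hCZ : C ⊆ Z := connectedComponentIn_subset _ _
  have hpre : IsPreconnected C := isPreconnected_connectedComponentIn
  have hfr : ∀ y ∈ closure C, y ∉ C → F y = 0 := by
    intro y hy hn
    by_contra h
    have hyD : y ∈ connectedComponentIn Z y := mem_connectedComponentIn h
    obtain ⟨z, hz1, hz2⟩ := mem_closure_iff.1 hy _ (hZo.connectedComponentIn (x := y)) hyD
    apply hn
    rw [hC, connectedComponentIn_eq hz2, ← connectedComponentIn_eq hz1]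
    exact hyD
  have hsign : ∀ y ∈ C, ∀ z ∈ C, F y < 0 → 0 < F z → False := by
    intro y hy z hz h1 h2
    obtain ⟨w, hw, hw0⟩ := hpre.intermediate_value hy hz hF.continuous.continuousOn ⟨h1.le, h2.le⟩
    exact hCZ hw hw0
  rcases lt_or_gt_of_ne hx with h | h
  · refine fk_component (fun y => - F y) hF.neg ?_ C hO hb ⟨x, hxC⟩ ?_ ?_
    · intro y
      have := hEq y
      simp only [laplacian, fderiv_fun_neg, ContinuousLinearMap.neg_apply, Fin.sum_univ_two] at this ⊢
      linarith
    · intro y hy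
      rcases lt_or_gt_of_ne (hCZ hy) with h' | h'
      · linarith
      · exact (hsign x hxC y hy h h').elim
    · intro y hy hn; simp [hfr y hy hn]
  · refine fk_component F hF hEq C hO hb ⟨x, hxC⟩ ?_ hfr
    intro y hy
    rcases lt_or_gt_of_ne (hCZ hy) with h' | h'
    · exact (hsign y hy x hxC h' h).elim
    · exact h'

lemma fk_count (F : EuclideanSpace ℝ (Fin 2) → ℝ) (hF : ContDiff ℝ 2 F)
    (hEq : ∀ x, laplacian F x + F x = 0) (B : Set (EuclideanSpace ℝ (Fin 2)))
    (hb : Bornology.IsBounded B) (u : Finset (Set (EuclideanSpace ℝ (Fin 2))))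
    (hu : (u : Set (Set (EuclideanSpace ℝ (Fin 2)))) ⊆ nodalDomainsIn F B) :
    (u.card : ℝ) * (Real.pi * besselJZero 0 1 ^ 2) ≤ volume.real B := by
  have hBfin : volume B ≠ ⊤ := hb.measure_lt_top.ne
  have hZo : IsOpen {y | F y ≠ 0} := isOpen_ne_fun hF.continuous continuous_const
  have h1 : ∀ C ∈ u, Real.pi * besselJZero 0 1 ^ 2 ≤ volume.real C := by
    intro C hC
    obtain ⟨⟨x, hx, rfl⟩, hCB⟩ := hu hC
    exact fk_nodal F hF hEq x hx (hb.subset hCB)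
  have hdis : Set.PairwiseDisjoint (u : Set (Set (EuclideanSpace ℝ (Fin 2)))) id := by
    intro C hC D hD hne
    obtain ⟨⟨x, hx, rfl⟩, -⟩ := hu hC
    obtain ⟨⟨y, hy, rfl⟩, -⟩ := hu hD
    refine Set.disjoint_left.2 fun z hz1 hz2 => hne ?_
    simp only [id] at hz1 hz2
    rw [connectedComponentIn_eq hz1, connectedComponentIn_eq hz2]
  have hms : ∀ C ∈ u, MeasurableSet (id C) := by
    intro C hC
    obtain ⟨⟨x, hx, rfl⟩, -⟩ := hu hC
    exact hZo.connectedComponentIn.measurableSet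
  have hsub : (⋃ C ∈ u, id C) ⊆ B := Set.iUnion₂_subset fun C hC => (hu hC).2
  calc (u.card : ℝ) * (Real.pi * besselJZero 0 1 ^ 2) = ∑ C ∈ u, Real.pi * besselJZero 0 1 ^ 2 := by simp
    _ ≤ ∑ C ∈ u, volume.real (id C) := Finset.sum_le_sum h1
    _ = volume.real (⋃ C ∈ u, id C) := by
        rw [measureReal_biUnion_finset hdis hms
          (fun C hC => measure_ne_top_of_subset (hu hC).2 hBfin)]
    _ ≤ volume.real B := measureReal_mono hsub hBfin

lemma fk_finite_count {α : Type*} (A : Set α) (c V : ℝ) (hc : 0 < c)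
    (h : ∀ u : Finset α, (u : Set α) ⊆ A → (u.card : ℝ) * c ≤ V) :
    A.Finite ∧ (A.ncard : ℝ) * c ≤ V := by
  have hfin : A.Finite := by
    by_contra hinf
    obtain ⟨n, hn⟩ := exists_nat_gt (V / c)
    obtain ⟨u, hu, hcard⟩ := Set.Infinite.exists_subset_card_eq hinf n
    have := h u hu
    rw [hcard] at this
    rw [div_lt_iff₀ hc] at hn
    linarith
  refine ⟨hfin, ?_⟩
  rw [Set.ncard_eq_toFinset_card A hfin]
  exact h _ (by simp)

/-- If `ΔF + F = 0` and `0 ≤ s < t`, then the number of nodal domains of `F`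
entirely contained in the annulus `{s < |x| < t}` is finite and at most
`(t² - s²)/j₀₁²`.  In particular, if `t < √2 j₀₁` there is at most one nodal
domain contained in the ball `{|x| < t}`, and if `t² - s² < j₀₁²` there is no
nodal domain contained in the annulus. -/
theorem nodal_domains_in_annulus_count
    (F : EuclideanSpace ℝ (Fin 2) → ℝ) (hF : ContDiff ℝ (⊤ : ℕ∞) F)
    (hEq : ∀ x, laplacian F x + F x = 0)
    (s t : ℝ) (hs : 0 ≤ s) (hst : s < t) :
    (nodalDomainsIn F {x | s < ‖x‖ ∧ ‖x‖ < t}).Finite ∧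
    ((nodalDomainsIn F {x | s < ‖x‖ ∧ ‖x‖ < t}).ncard : ℝ)
      ≤ (t ^ 2 - s ^ 2) / besselJZero 0 1 ^ 2 ∧
    (t < Real.sqrt 2 * besselJZero 0 1 →
      (nodalDomainsIn F {x | ‖x‖ < t}).ncard ≤ 1) ∧
    (t ^ 2 - s ^ 2 < besselJZero 0 1 ^ 2 →
      nodalDomainsIn F {x | s < ‖x‖ ∧ ‖x‖ < t} = ∅) := by
  have hF2 : ContDiff ℝ 2 F := hF.of_le (by
    change ((2 : ℕ∞) : WithTop ℕ∞) ≤ ((⊤ : ℕ∞) : WithTop ℕ∞)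
    exact WithTop.coe_le_coe.2 le_top)
  have hj := fk_besselJZero_pos.1
  set j := besselJZero 0 1 with hjdef
  have hpi := Real.pi_pos
  have hc : 0 < Real.pi * j ^ 2 := by positivity
  have hball : {x : EuclideanSpace ℝ (Fin 2) | ‖x‖ < t} = ball 0 t := by
    ext x; simp
  have hann : {x : EuclideanSpace ℝ (Fin 2) | s < ‖x‖ ∧ ‖x‖ < t} = ball 0 t \ closedBall 0 s := by
    ext x; simp [and_comm]
  have ht : 0 < t := lt_of_le_of_lt hs hst
  have hvb : volume.real (ball (0 : EuclideanSpace ℝ (Fin 2)) t) = Real.pi * t ^ 2 := by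
    rw [measureReal_def, EuclideanSpace.volume_ball_fin_two]
    simp [ENNReal.toReal_ofReal ht.le, mul_comm, hpi.le]
  have hvc : volume.real (closedBall (0 : EuclideanSpace ℝ (Fin 2)) s) = Real.pi * s ^ 2 := by
    rw [measureReal_def, EuclideanSpace.volume_closedBall_fin_two]
    simp [ENNReal.toReal_ofReal hs, mul_comm, hpi.le]
  have hva : volume.real {x : EuclideanSpace ℝ (Fin 2) | s < ‖x‖ ∧ ‖x‖ < t} =
      Real.pi * (t ^ 2 - s ^ 2) := by
    rw [hann, measureReal_diff (closedBall_subset_ball hst) measurableSet_closedBall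
      measure_ball_lt_top.ne, hvb, hvc]
    ring
  have hbb : Bornology.IsBounded {x : EuclideanSpace ℝ (Fin 2) | ‖x‖ < t} := by
    rw [hball]; exact isBounded_ball
  have hba : Bornology.IsBounded {x : EuclideanSpace ℝ (Fin 2) | s < ‖x‖ ∧ ‖x‖ < t} :=
    hbb.subset fun x hx => hx.2
  obtain ⟨hfin, hcard⟩ := fk_finite_count _ _ _ hc (fk_count F hF2 hEq _ hba)
  obtain ⟨hfinb, hcardb⟩ := fk_finite_count _ _ _ hc (fk_count F hF2 hEq _ hbb)
  rw [hva] at hcard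
  rw [hball, hvb, ← hball] at hcardb
  have hcard2 : ((nodalDomainsIn F {x | s < ‖x‖ ∧ ‖x‖ < t}).ncard : ℝ) * j ^ 2 ≤ t ^ 2 - s ^ 2 := by
    refine le_of_mul_le_mul_left ?_ hpi
    linarith
  have hcardb2 : ((nodalDomainsIn F {x | ‖x‖ < t}).ncard : ℝ) * j ^ 2 ≤ t ^ 2 := by
    refine le_of_mul_le_mul_left ?_ hpi
    linarith
  refine ⟨hfin, ?_, ?_, ?_⟩
  · rwa [le_div_iff₀ (by positivity)]
  · intro htj
    by_contra hn
    have h2 : (2 : ℝ) ≤ ((nodalDomainsIn F {x | ‖x‖ < t}).ncard : ℝ) := by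
      exact_mod_cast (by omega : 2 ≤ (nodalDomainsIn F {x | ‖x‖ < t}).ncard)
    have h3 : t ^ 2 < (Real.sqrt 2 * j) ^ 2 := pow_lt_pow_left₀ htj ht.le (by norm_num)
    rw [mul_pow, Real.sq_sqrt (by norm_num)] at h3
    nlinarith [mul_le_mul_of_nonneg_right h2 (sq_nonneg j)]
  · intro hlt
    by_contra hn
    have h1 : 1 ≤ (nodalDomainsIn F {x | s < ‖x‖ ∧ ‖x‖ < t}).ncard :=
      (Set.ncard_pos hfin).2 (Set.nonempty_iff_ne_empty.2 hn)
    have h2 : (1 : ℝ) ≤ ((nodalDomainsIn F {x | s < ‖x‖ ∧ ‖x‖ < t}).ncard : ℝ) := by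
      exact_mod_cast h1
    nlinarith [mul_le_mul_of_nonneg_right h2 (sq_nonneg j)]
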